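/- arXiv:1711.04024 — 8 statements merged into one kernel-verified Lean document; each statement's English description precedes it below -/
import Mathlib

section
/- Conditionally on {θ = 1}, the action of player t is determined by R_{t-1}, X_t, and I_t as follows: if R_{t-1} < b/a then Z_t = 1 when I_t = 1 and X_t = 1, and Z_t = 2 otherwise, so that P_1(Z_t = 1 | F_{t-1}) = (a/(a+b))·p_t on this event; if R_{t-1} ∈ [b/a, a/b] then Z_t = X_t, so that P_1(Z_t = 1 | F_{t-1}) = a/(a+b) on this event; and if R_{t-1} > a/b then Z_t = 2 when I_t = 1 and X_t = 2, and Z_t = 1 otherwise, so that P_1(Z_t = 1 | F_{t-1}) = 1 − (b/(a+b))·p_t on this event. The analogous formulas hold conditionally on {θ = 2} with a and b interchanged in the signal probabilities. -/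
open MeasureTheory ProbabilityTheory Filter Asymptotics
open scoped ENNReal NNReal

noncomputable section

/-- The constant `κ*(a,b)` from the paper. -/
def kappaStar (a b : ℝ) : ℝ :=
  1 / (1 + (a / b - 1) / Real.log (a / b) *
      (Real.log ((a / b - 1) / Real.log (a / b)) - 1))

/-- The signal distribution: `signalProb a b i x = P(X_t = x | θ = i)`,
equal to `a/(a+b)` if `x = i` and `b/(a+b)` otherwise. -/
def signalProb (a b : ℝ) (i x : ℕ) : ℝ :=
  if x = i then a / (a + b) else b / (a + b)

/-- The D-likelihood `D_i^t = Q_i^t(Z_1,…,Z_{t-1},X_t)`: the conditional probability, given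
`θ = i`, of observing the actions `Z_1,…,Z_{t-1}` and private signal `X_t` that actually
occurred at the sample point `ω`. -/
def Dlike {Ω : Type*} [MeasurableSpace Ω] (μ : Measure Ω) (θ : Ω → ℕ)
    (X Z : ℕ → Ω → ℕ) (t : ℕ) (i : ℕ) (ω : Ω) : ℝ :=
  (μ {ω' | θ ω' = i ∧ (∀ s ∈ Finset.Icc 1 (t - 1), Z s ω' = Z s ω) ∧ X t ω' = X t ω}).toReal
    / (μ {ω' | θ ω' = i}).toReal

/-- The maximum a posteriori estimate of `θ` given `(Z_1,…,Z_{t-1},X_t)`, with ties broken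
by following the private signal `X_t`.  (The prior on `θ` is uniform, so comparing the
posteriors amounts to comparing `D_1^t` and `D_2^t`.) -/
def mapEst {Ω : Type*} [MeasurableSpace Ω] (μ : Measure Ω) (θ : Ω → ℕ)
    (X Z : ℕ → Ω → ℕ) (t : ℕ) (ω : Ω) : ℕ :=
  if Dlike μ θ X Z t 2 ω < Dlike μ θ X Z t 1 ω then 1
  else if Dlike μ θ X Z t 1 ω < Dlike μ θ X Z t 2 ω then 2
  else X t ω

/-- The L-likelihood `L_i^t = P_i(Z_1 = z_1, …, Z_t = z_t)` evaluated at the observed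
actions. -/
def Llike {Ω : Type*} [MeasurableSpace Ω] (μ : Measure Ω) (θ : Ω → ℕ)
    (Z : ℕ → Ω → ℕ) (t : ℕ) (i : ℕ) (ω : Ω) : ℝ :=
  (μ {ω' | θ ω' = i ∧ ∀ s ∈ Finset.Icc 1 t, Z s ω' = Z s ω}).toReal
    / (μ {ω' | θ ω' = i}).toReal

/-- The likelihood ratio `R_t = L_1^t / L_2^t` (with `R_0 = 1`). -/
def LR {Ω : Type*} [MeasurableSpace Ω] (μ : Measure Ω) (θ : Ω → ℕ)
    (Z : ℕ → Ω → ℕ) (t : ℕ) (ω : Ω) : ℝ :=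
  Llike μ θ Z t 1 ω / Llike μ θ Z t 2 ω

/-- The sequential decision making model with Bayesians and revealers.
`θ` is the state of the world, uniform on `{1,2}`; given `θ`, the signals `X_t` are i.i.d.
with `P(X_t = θ | θ) = a/(a+b)`, the revealing indicators `I_t` are independent Bernoulli
with `E[I_t] = p_t`, independent of everything else (this is the content of `joint`), and
the actions are `Z_t = X_t` if `I_t = 1` and `Z_t = MAP(Z_1,…,Z_{t-1},X_t)` if `I_t = 0`
(field `dynamics`).  Players are indexed by `t ≥ 1`; `Z 0` is set to the constant `1` for
definiteness. -/
structure IsCascade (a b : ℝ) (p : ℕ → ℝ) {Ω : Type*} [MeasurableSpace Ω]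
    (μ : Measure Ω) (θ : Ω → ℕ) (X I Z : ℕ → Ω → ℕ) : Prop where
  prob : IsProbabilityMeasure μ
  theta_meas : Measurable θ
  X_meas : ∀ t, Measurable (X t)
  I_meas : ∀ t, Measurable (I t)
  Z_meas : ∀ t, Measurable (Z t)
  p_mem : ∀ t : ℕ, 1 ≤ t → p t ∈ Set.Icc (0 : ℝ) 1
  theta_range : ∀ ω, θ ω = 1 ∨ θ ω = 2
  X_range : ∀ t ω, X t ω = 1 ∨ X t ω = 2
  I_range : ∀ t ω, I t ω = 0 ∨ I t ω = 1
  Z_zero : ∀ ω, Z 0 ω = 1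
  joint : ∀ i : ℕ, i = 1 ∨ i = 2 → ∀ s : Finset ℕ, (∀ t ∈ s, 1 ≤ t) →
    ∀ x c : ℕ → ℕ, (∀ t, x t = 1 ∨ x t = 2) → (∀ t, c t = 0 ∨ c t = 1) →
    (μ {ω | θ ω = i ∧ ∀ t ∈ s, X t ω = x t ∧ I t ω = c t}).toReal
      = 1 / 2 * ∏ t ∈ s, signalProb a b i (x t) * (if c t = 1 then p t else 1 - p t)
  dynamics : ∀ t : ℕ, 1 ≤ t → ∀ ω,
    Z t ω = if I t ω = 1 then X t ω else mapEst μ θ X Z t ω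

/-- The error probability `E_t = P(Z_t ≠ θ)`. -/
def errProb {Ω : Type*} [MeasurableSpace Ω] (μ : Measure Ω) (θ : Ω → ℕ)
    (Z : ℕ → Ω → ℕ) (t : ℕ) : ℝ :=
  (μ {ω | Z t ω ≠ θ ω}).toReal

/-- The probability that the MAP estimator is wrong at time `t`:
`P(MAP(Z_1,…,Z_{t-1},X_t) ≠ θ)`. -/
def mapErr {Ω : Type*} [MeasurableSpace Ω] (μ : Measure Ω) (θ : Ω → ℕ)
    (X Z : ℕ → Ω → ℕ) (t : ℕ) : ℝ :=
  (μ {ω | mapEst μ θ X Z t ω ≠ θ ω}).toReal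

/-- The history of actions is a function of the signals and revealing indicators. -/
theorem Z_determined {a b : ℝ} {p : ℕ → ℝ} {Ω : Type*} [MeasurableSpace Ω] {μ : Measure Ω}
    {θ : Ω → ℕ} {X I Z : ℕ → Ω → ℕ} (hC : IsCascade a b p μ θ X I Z) (n : ℕ) (ω ω' : Ω)
    (h : ∀ s ∈ Finset.Icc 1 n, X s ω = X s ω' ∧ I s ω = I s ω') :
    ∀ s ∈ Finset.Icc 1 n, Z s ω = Z s ω' := by
  intro s
  induction s using Nat.strong_induction_on with
  | _ s ih =>
    intro hs
    have hs' := Finset.mem_Icc.1 hs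
    have hZ : ∀ r ∈ Finset.Icc 1 (s - 1), Z r ω = Z r ω' := by
      intro r hr
      have hr' := Finset.mem_Icc.1 hr
      exact ih r (by omega) (Finset.mem_Icc.2 (by omega))
    have hD : ∀ i, Dlike μ θ X Z s i ω = Dlike μ θ X Z s i ω' := by
      intro i
      unfold Dlike
      congr 3
      ext ω''
      simp only [Set.mem_setOf_eq, (h s hs).1]
      have : (∀ r ∈ Finset.Icc 1 (s - 1), Z r ω'' = Z r ω) ↔
          (∀ r ∈ Finset.Icc 1 (s - 1), Z r ω'' = Z r ω') :=
        forall₂_congr fun r hr => by rw [hZ r hr]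
      rw [this]
    rw [hC.dynamics s hs'.1, hC.dynamics s hs'.1, (h s hs).2, (h s hs).1]
    unfold mapEst
    rw [hD, hD, (h s hs).1]

/-- Decomposition of a set along a finite-valued measurable map. -/
theorem sum_fibers {Ω β : Type*} [MeasurableSpace Ω] [Fintype β] (μ : Measure Ω)
    [IsFiniteMeasure μ] (V : Ω → β) (hV : ∀ f, MeasurableSet (V ⁻¹' {f})) (B : Set Ω) :
    μ.real B = ∑ f, μ.real (V ⁻¹' {f} ∩ B) := by
  have := sum_measureReal_preimage_singleton (μ := μ.restrict B) (Finset.univ : Finset β)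
    (f := V) (fun y _ => hV y)
  simp only [Finset.coe_univ, Set.preimage_univ] at this
  rw [measureReal_restrict_apply MeasurableSet.univ, Set.univ_inter] at this
  rw [← this]
  exact Finset.sum_congr rfl fun f _ => measureReal_restrict_apply (hV f)

/-- Independence of the past and the current pair of signal and indicator. -/
theorem past_indep {a b : ℝ} {p : ℕ → ℝ} {Ω : Type*} [MeasurableSpace Ω] {μ : Measure Ω}
    {θ : Ω → ℕ} {X I Z : ℕ → Ω → ℕ} (hC : IsCascade a b p μ θ X I Z) (t : ℕ) (ht : 1 ≤ t)
    (A : Set Ω) (hA : ∀ ω ω', (∀ s ∈ Finset.Icc 1 (t - 1), X s ω = X s ω' ∧ I s ω = I s ω') →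
      ω ∈ A → ω' ∈ A) (i : ℕ) (hi : i = 1 ∨ i = 2) (x c : ℕ) (hx : x = 1 ∨ x = 2)
    (hc : c = 0 ∨ c = 1) :
    μ.real (A ∩ {ω | θ ω = i} ∩ {ω | X t ω = x ∧ I t ω = c}) =
      μ.real (A ∩ {ω | θ ω = i}) * (signalProb a b i x * (if c = 1 then p t else 1 - p t)) := by
  haveI := hC.prob
  classical
  let S := Finset.Icc 1 (t - 1)
  let V : Ω → (S → Bool × Bool) := fun ω n => (decide (X n ω = 1), decide (I n ω = 1))
  let xf : (S → Bool × Bool) → ℕ → ℕ := fun f n =>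
    if n = t then x else if h : n ∈ S then (if (f ⟨n, h⟩).1 then 1 else 2) else 1
  let cf : (S → Bool × Bool) → ℕ → ℕ := fun f n =>
    if n = t then c else if h : n ∈ S then (if (f ⟨n, h⟩).2 then 1 else 0) else 1
  have htS : t ∉ S := by simp [S]; omega
  have hpat : ∀ f ω, V ω = f ↔ ∀ n ∈ S, X n ω = xf f n ∧ I n ω = cf f n := by
    intro f ω
    rw [funext_iff, Subtype.forall]
    refine forall₂_congr fun n hn => ?_
    have hnt : n ≠ t := fun h => htS (h ▸ hn)
    simp only [V, xf, cf, hnt, if_false, hn, dif_pos]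
    rw [Prod.ext_iff]
    refine and_congr ?_ ?_
    · rcases hC.X_range n ω with h | h <;> rcases (f ⟨n, hn⟩).1 with _ | _ <;> simp [h]
    · rcases hC.I_range n ω with h | h <;> rcases (f ⟨n, hn⟩).2 with _ | _ <;> simp [h]
  have hxr : ∀ f n, xf f n = 1 ∨ xf f n = 2 := by
    intro f n; simp only [xf]; split_ifs <;> simp [hx]
  have hcr : ∀ f n, cf f n = 0 ∨ cf f n = 1 := by
    intro f n; simp only [cf]; split_ifs <;> simp [hc]
  have hV : ∀ f, MeasurableSet (V ⁻¹' {f}) := by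
    intro f
    have : V ⁻¹' {f} = ⋂ n ∈ S, ((X n) ⁻¹' {xf f n} ∩ (I n) ⁻¹' {cf f n}) := by
      ext ω
      simp only [Set.mem_preimage, Set.mem_singleton_iff, hpat, Set.mem_iInter, Set.mem_inter_iff]
    rw [this]
    exact Finset.measurableSet_biInter _ fun n _ =>
      ((hC.X_meas n) (measurableSet_singleton _)).inter ((hC.I_meas n) (measurableSet_singleton _))
  rw [sum_fibers μ V hV (A ∩ {ω | θ ω = i} ∩ {ω | X t ω = x ∧ I t ω = c}),
    sum_fibers μ V hV (A ∩ {ω | θ ω = i}), Finset.sum_mul]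
  refine Finset.sum_congr rfl fun f _ => ?_
  have hagree : ∀ ω ω', V ω = f → V ω' = f → ω ∈ A → ω' ∈ A := by
    intro ω ω' h h'
    refine hA ω ω' fun s hs => ?_
    have e := (hpat f ω).1 h s hs
    have e' := (hpat f ω').1 h' s hs
    exact ⟨e.1.trans e'.1.symm, e.2.trans e'.2.symm⟩
  by_cases hne : ∃ ω, V ω = f ∧ ω ∈ A
  · obtain ⟨ω1, hω1, hω1A⟩ := hne
    have e1 : V ⁻¹' {f} ∩ (A ∩ {ω | θ ω = i}) =
        {ω | θ ω = i ∧ ∀ n ∈ S, X n ω = xf f n ∧ I n ω = cf f n} := by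
      ext ω
      simp only [Set.mem_inter_iff, Set.mem_preimage, Set.mem_singleton_iff, Set.mem_setOf_eq,
        ← hpat]
      exact ⟨fun h => ⟨h.2.2, h.1⟩, fun h => ⟨h.2, hagree _ _ hω1 h.2 hω1A, h.1⟩⟩
    have e2 : V ⁻¹' {f} ∩ (A ∩ {ω | θ ω = i} ∩ {ω | X t ω = x ∧ I t ω = c}) =
        {ω | θ ω = i ∧ ∀ n ∈ insert t S, X n ω = xf f n ∧ I n ω = cf f n} := by
      rw [← Set.inter_assoc, e1]
      ext ω
      simp only [Set.mem_inter_iff, Set.mem_setOf_eq, Finset.forall_mem_insert]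
      have : xf f t = x ∧ cf f t = c := by simp [xf, cf]
      rw [this.1, this.2]
      tauto
    rw [e1, e2, measureReal_def, measureReal_def,
      hC.joint i hi S (fun n hn => (Finset.mem_Icc.1 hn).1) _ _ (hxr f) (hcr f),
      hC.joint i hi (insert t S) ?_ _ _ (hxr f) (hcr f), Finset.prod_insert htS]
    · have : xf f t = x ∧ cf f t = c := by simp [xf, cf]
      rw [this.1, this.2]
      ring
    · intro n hn
      rcases Finset.mem_insert.1 hn with h | h
      · omega
      · exact (Finset.mem_Icc.1 h).1
  · have e1 : V ⁻¹' {f} ∩ (A ∩ {ω | θ ω = i}) = ∅ := by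
      ext ω
      simp only [Set.mem_inter_iff, Set.mem_preimage, Set.mem_singleton_iff, Set.mem_empty_iff_false,
        iff_false]
      exact fun h => hne ⟨ω, h.1, h.2.1⟩
    rw [← Set.inter_assoc, e1, Set.empty_inter]
    simp

/-- Marginal version of `past_indep` for the signal alone. -/
theorem past_indep_X {a b : ℝ} {p : ℕ → ℝ} {Ω : Type*} [MeasurableSpace Ω] {μ : Measure Ω}
    {θ : Ω → ℕ} {X I Z : ℕ → Ω → ℕ} (hC : IsCascade a b p μ θ X I Z) (t : ℕ) (ht : 1 ≤ t)
    (A : Set Ω) (hA : ∀ ω ω', (∀ s ∈ Finset.Icc 1 (t - 1), X s ω = X s ω' ∧ I s ω = I s ω') →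
      ω ∈ A → ω' ∈ A) (i : ℕ) (hi : i = 1 ∨ i = 2) (x : ℕ) (hx : x = 1 ∨ x = 2) :
    μ.real (A ∩ {ω | θ ω = i} ∩ {ω | X t ω = x}) =
      μ.real (A ∩ {ω | θ ω = i}) * signalProb a b i x := by
  haveI := hC.prob
  have hm : MeasurableSet {ω | I t ω = 1} := hC.I_meas t (measurableSet_singleton 1)
  rw [← measureReal_inter_add_diff (s := A ∩ {ω | θ ω = i} ∩ {ω | X t ω = x}) hm]
  have e1 : A ∩ {ω | θ ω = i} ∩ {ω | X t ω = x} ∩ {ω | I t ω = 1} =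
      A ∩ {ω | θ ω = i} ∩ {ω | X t ω = x ∧ I t ω = 1} := by
    rw [Set.inter_assoc]; rfl
  have e0 : (A ∩ {ω | θ ω = i} ∩ {ω | X t ω = x}) \ {ω | I t ω = 1} =
      A ∩ {ω | θ ω = i} ∩ {ω | X t ω = x ∧ I t ω = 0} := by
    ext ω
    simp only [Set.mem_diff, Set.mem_inter_iff, Set.mem_setOf_eq]
    have : ¬ I t ω = 1 ↔ I t ω = 0 := by
      rcases hC.I_range t ω with h | h <;> simp [h]
    rw [this, and_assoc]
  rw [e1, e0, past_indep hC t ht A hA i hi x 1 hx (Or.inr rfl),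
    past_indep hC t ht A hA i hi x 0 hx (Or.inl rfl)]
  simp
  ring

/-- From a ratio of measures to the conditional probability. -/
theorem cond_of_real {Ω : Type*} [MeasurableSpace Ω] (μ : Measure Ω) [IsFiniteMeasure μ]
    (B E : Set Ω) (hE : MeasurableSet E) (hB : μ B ≠ 0) (q : ℝ)
    (h : μ.real (B ∩ E) = μ.real B * q) : (μ[|B] E).toReal = q := by
  have hB' : μ.real B ≠ 0 := by
    rw [measureReal_def, ENNReal.toReal_ne_zero]
    exact ⟨hB, measure_ne_top _ _⟩
  rw [cond_apply' hE, ENNReal.toReal_mul, ENNReal.toReal_inv]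
  change (μ.real B)⁻¹ * μ.real (B ∩ E) = q
  rw [h]
  field_simp

/-- Conditionally on the history `(Z_1,…,Z_{t-1})` (here: the event of
agreeing with a reference point `ω0` on the first `t-1` actions, which has positive
probability together with `{θ = 1}` and with `{θ = 2}`), the action of player `t` is
determined by `R_{t-1}`, `X_t` and `I_t` as follows.
If `R_{t-1} < b/a` then `Z_t = 1` iff `I_t = 1` and `X_t = 1` (else `Z_t = 2`), and
`P_1(Z_t = 1 | F_{t-1}) = (a/(a+b))·p_t` while `P_2(Z_t = 1 | F_{t-1}) = (b/(a+b))·p_t`.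
If `R_{t-1} ∈ [b/a, a/b]` then `Z_t = X_t`, and `P_1(Z_t = 1 | F_{t-1}) = a/(a+b)` while
`P_2(Z_t = 1 | F_{t-1}) = b/(a+b)`.
If `R_{t-1} > a/b` then `Z_t = 2` iff `I_t = 1` and `X_t = 2` (else `Z_t = 1`), and
`P_1(Z_t = 1 | F_{t-1}) = 1 − (b/(a+b))·p_t` while
`P_2(Z_t = 1 | F_{t-1}) = 1 − (a/(a+b))·p_t`. -/
theorem action_given_history (a b : ℝ) (hb : 0 < b) (hab : b < a)
    (p : ℕ → ℝ) {Ω : Type*} [MeasurableSpace Ω] (μ : Measure Ω) (θ : Ω → ℕ)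
    (X I Z : ℕ → Ω → ℕ) (hC : IsCascade a b p μ θ X I Z) (t : ℕ) (ht : 1 ≤ t)
    (ω0 : Ω)
    (h1 : μ ({ω | ∀ s ∈ Finset.Icc 1 (t - 1), Z s ω = Z s ω0} ∩ {ω | θ ω = 1}) ≠ 0)
    (h2 : μ ({ω | ∀ s ∈ Finset.Icc 1 (t - 1), Z s ω = Z s ω0} ∩ {ω | θ ω = 2}) ≠ 0) :
    (LR μ θ Z (t - 1) ω0 < b / a →
      (∀ ω, (∀ s ∈ Finset.Icc 1 (t - 1), Z s ω = Z s ω0) →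
        Z t ω = if I t ω = 1 ∧ X t ω = 1 then 1 else 2) ∧
      (μ[|{ω | ∀ s ∈ Finset.Icc 1 (t - 1), Z s ω = Z s ω0} ∩ {ω | θ ω = 1}]
          {ω | Z t ω = 1}).toReal = a / (a + b) * p t ∧
      (μ[|{ω | ∀ s ∈ Finset.Icc 1 (t - 1), Z s ω = Z s ω0} ∩ {ω | θ ω = 2}]
          {ω | Z t ω = 1}).toReal = b / (a + b) * p t) ∧
    (LR μ θ Z (t - 1) ω0 ∈ Set.Icc (b / a) (a / b) →
      (∀ ω, (∀ s ∈ Finset.Icc 1 (t - 1), Z s ω = Z s ω0) → Z t ω = X t ω) ∧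
      (μ[|{ω | ∀ s ∈ Finset.Icc 1 (t - 1), Z s ω = Z s ω0} ∩ {ω | θ ω = 1}]
          {ω | Z t ω = 1}).toReal = a / (a + b) ∧
      (μ[|{ω | ∀ s ∈ Finset.Icc 1 (t - 1), Z s ω = Z s ω0} ∩ {ω | θ ω = 2}]
          {ω | Z t ω = 1}).toReal = b / (a + b)) ∧
    (a / b < LR μ θ Z (t - 1) ω0 →
      (∀ ω, (∀ s ∈ Finset.Icc 1 (t - 1), Z s ω = Z s ω0) →
        Z t ω = if I t ω = 1 ∧ X t ω = 2 then 2 else 1) ∧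
      (μ[|{ω | ∀ s ∈ Finset.Icc 1 (t - 1), Z s ω = Z s ω0} ∩ {ω | θ ω = 1}]
          {ω | Z t ω = 1}).toReal = 1 - b / (a + b) * p t ∧
      (μ[|{ω | ∀ s ∈ Finset.Icc 1 (t - 1), Z s ω = Z s ω0} ∩ {ω | θ ω = 2}]
          {ω | Z t ω = 1}).toReal = 1 - a / (a + b) * p t) := by
  haveI := hC.prob
  have ha : 0 < a := hb.trans hab
  set H : Set Ω := {ω | ∀ s ∈ Finset.Icc 1 (t - 1), Z s ω = Z s ω0} with hHdef
  have hHdet : ∀ ω ω', (∀ s ∈ Finset.Icc 1 (t - 1), X s ω = X s ω' ∧ I s ω = I s ω') →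
      ω ∈ H → ω' ∈ H := by
    intro ω ω' h hω s hs
    rw [← Z_determined hC (t - 1) ω ω' h s hs]
    exact hω s hs
  have hZm : MeasurableSet {ω | Z t ω = 1} := hC.Z_meas t (measurableSet_singleton 1)
  set m : ℕ → ℝ := fun i => μ.real (H ∩ {ω | θ ω = i}) with hm
  have hm1 : 0 < m 1 := ENNReal.toReal_pos h1 (measure_ne_top _ _)
  have hm2 : 0 < m 2 := ENNReal.toReal_pos h2 (measure_ne_top _ _)
  have hθ : ∀ i, (i = 1 ∨ i = 2) → (μ {ω | θ ω = i}).toReal = 1 / 2 := by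
    intro i hi
    have := hC.joint i hi ∅ (by simp) (fun _ => 1) (fun _ => 1) (by simp) (by simp)
    simpa using this
  have hL : ∀ i, (i = 1 ∨ i = 2) → Llike μ θ Z (t - 1) i ω0 = 2 * m i := by
    intro i hi
    unfold Llike
    rw [hθ i hi]
    have : {ω' | θ ω' = i ∧ ∀ s ∈ Finset.Icc 1 (t - 1), Z s ω' = Z s ω0} =
        H ∩ {ω | θ ω = i} := by
      ext ω; exact and_comm
    rw [this]
    simp only [hm, measureReal_def]
    ring
  have hLR : LR μ θ Z (t - 1) ω0 = m 1 / m 2 := by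
    unfold LR
    rw [hL 1 (Or.inl rfl), hL 2 (Or.inr rfl)]
    field_simp
  have hD : ∀ i, (i = 1 ∨ i = 2) → ∀ ω ∈ H,
      Dlike μ θ X Z t i ω = 2 * m i * signalProb a b i (X t ω) := by
    intro i hi ω hω
    unfold Dlike
    rw [hθ i hi]
    have : {ω' | θ ω' = i ∧ (∀ s ∈ Finset.Icc 1 (t - 1), Z s ω' = Z s ω) ∧ X t ω' = X t ω} =
        H ∩ {ω | θ ω = i} ∩ {ω' | X t ω' = X t ω} := by
      ext ω'
      have e : (∀ s ∈ Finset.Icc 1 (t - 1), Z s ω' = Z s ω) ↔ ω' ∈ H :=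
        forall₂_congr fun s hs => by rw [hω s hs]
      simp only [Set.mem_setOf_eq, Set.mem_inter_iff, e]
      tauto
    rw [this]
    have := past_indep_X hC t ht H hHdet i hi (X t ω) (hC.X_range t ω)
    rw [measureReal_def] at this
    rw [this]
    simp only [hm]
    ring
  have hab0 : 0 < a + b := by linarith
  -- comparison of D-likelihoods
  have hmap : ∀ ω ∈ H, mapEst μ θ X Z t ω =
      if X t ω = 1 then (if m 1 * a < m 2 * b then 2 else 1)
      else (if m 2 * a < m 1 * b then 1 else 2) := by
    intro ω hω
    unfold mapEst
    rw [hD 1 (Or.inl rfl) ω hω, hD 2 (Or.inr rfl) ω hω]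
    have key : ∀ u v c d : ℝ, 2 * u * (c / (a + b)) < 2 * v * (d / (a + b)) ↔ u * c < v * d := by
      intro u v c d
      rw [← mul_div_assoc, ← mul_div_assoc, div_lt_div_iff_of_pos_right hab0]
      constructor <;> intro h <;> linarith
    rcases hC.X_range t ω with h | h
    · simp only [h, signalProb, if_true, key]
      norm_num
      simp only [key]
      split_ifs <;> first | rfl | linarith
    · simp only [h, signalProb, if_true]
      norm_num
      simp only [key]
  have q1 : ∀ x, (x = 1 ∨ x = 2) → ∀ c, (c = 0 ∨ c = 1) → ∀ i, (i = 1 ∨ i = 2) → 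
      μ.real (H ∩ {ω | θ ω = i} ∩ {ω | X t ω = x ∧ I t ω = c}) =
        m i * (signalProb a b i x * (if c = 1 then p t else 1 - p t)) :=
    fun x hx c hc i hi => past_indep hC t ht H hHdet i hi x c hx hc
  have q2 : ∀ x, (x = 1 ∨ x = 2) → ∀ i, (i = 1 ∨ i = 2) → 
      μ.real (H ∩ {ω | θ ω = i} ∩ {ω | X t ω = x}) = m i * signalProb a b i x :=
    fun x hx i hi => past_indep_X hC t ht H hHdet i hi x hx
  have hsum : a / (a + b) + b / (a + b) = 1 := by field_simp
  have hmi : ∀ i, (i = 1 ∨ i = 2) → μ (H ∩ {ω | θ ω = i}) ≠ 0 := by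
    rintro i (rfl | rfl) <;> assumption
  refine ⟨fun hR => ?_, fun hR => ?_, fun hR => ?_⟩
  · rw [hLR, div_lt_div_iff₀ hm2 ha] at hR
    have hZ : ∀ ω ∈ H, Z t ω = if I t ω = 1 ∧ X t ω = 1 then 1 else 2 := by
      intro ω hω
      have h' : ¬ m 2 * a < m 1 * b := by nlinarith
      have h'' : m 1 * a < m 2 * b := by linarith
      rw [hC.dynamics t ht ω, hmap ω hω, if_pos h'', if_neg h']
      rcases hC.X_range t ω with h | h <;> rcases hC.I_range t ω with g | g <;> simp [h, g]
    have hc : ∀ i, (i = 1 ∨ i = 2) → (μ[|H ∩ {ω | θ ω = i}] {ω | Z t ω = 1}).toReal =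
        signalProb a b i 1 * p t := by
      intro i hi
      refine cond_of_real μ _ _ hZm (hmi i hi) _ ?_
      have : H ∩ {ω | θ ω = i} ∩ {ω | Z t ω = 1} =
          H ∩ {ω | θ ω = i} ∩ {ω | X t ω = 1 ∧ I t ω = 1} := by
        ext ω
        refine and_congr_right fun hω => ?_
        simp only [Set.mem_setOf_eq, hZ ω hω.1]
        rcases hC.X_range t ω with h | h <;> rcases hC.I_range t ω with g | g <;> simp [h, g]
      rw [this, q1 1 (Or.inl rfl) 1 (Or.inr rfl) i hi]
      simp [hm]
    exact ⟨hZ, by rw [hc 1 (Or.inl rfl)]; simp [signalProb],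
      by rw [hc 2 (Or.inr rfl)]; simp [signalProb]⟩
  · rw [hLR] at hR
    have hR1 := hR.1
    have hR2 := hR.2
    rw [div_le_div_iff₀ ha hm2] at hR1
    rw [div_le_div_iff₀ hm2 hb] at hR2
    have hZ : ∀ ω ∈ H, Z t ω = X t ω := by
      intro ω hω
      have h' : ¬ m 2 * a < m 1 * b := by linarith
      have h'' : ¬ m 1 * a < m 2 * b := by linarith
      rw [hC.dynamics t ht ω, hmap ω hω, if_neg h'', if_neg h']
      rcases hC.X_range t ω with h | h <;> rcases hC.I_range t ω with g | g <;> simp [h, g]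
    have hc : ∀ i, (i = 1 ∨ i = 2) → (μ[|H ∩ {ω | θ ω = i}] {ω | Z t ω = 1}).toReal =
        signalProb a b i 1 := by
      intro i hi
      refine cond_of_real μ _ _ hZm (hmi i hi) _ ?_
      have : H ∩ {ω | θ ω = i} ∩ {ω | Z t ω = 1} =
          H ∩ {ω | θ ω = i} ∩ {ω | X t ω = 1} := by
        ext ω
        refine and_congr_right fun hω => ?_
        simp only [Set.mem_setOf_eq, hZ ω hω.1]
      rw [this, q2 1 (Or.inl rfl) i hi]
    exact ⟨hZ, by rw [hc 1 (Or.inl rfl)]; simp [signalProb],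
      by rw [hc 2 (Or.inr rfl)]; simp [signalProb]⟩
  · rw [hLR, div_lt_div_iff₀ hb hm2] at hR
    have hZ : ∀ ω ∈ H, Z t ω = if I t ω = 1 ∧ X t ω = 2 then 2 else 1 := by
      intro ω hω
      have h' : m 2 * a < m 1 * b := by linarith
      have h'' : ¬ m 1 * a < m 2 * b := by nlinarith
      rw [hC.dynamics t ht ω, hmap ω hω, if_neg h'', if_pos h']
      rcases hC.X_range t ω with h | h <;> rcases hC.I_range t ω with g | g <;> simp [h, g]
    have hc : ∀ i, (i = 1 ∨ i = 2) → (μ[|H ∩ {ω | θ ω = i}] {ω | Z t ω = 1}).toReal =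
        1 - signalProb a b i 2 * p t := by
      intro i hi
      refine cond_of_real μ _ _ hZm (hmi i hi) _ ?_
      have : (H ∩ {ω | θ ω = i}) \ {ω | Z t ω = 1} =
          H ∩ {ω | θ ω = i} ∩ {ω | X t ω = 2 ∧ I t ω = 1} := by
        ext ω
        refine and_congr_right fun hω => ?_
        simp only [Set.mem_setOf_eq, hZ ω hω.1]
        rcases hC.X_range t ω with h | h <;> rcases hC.I_range t ω with g | g <;> simp [h, g]
      have e := measureReal_inter_add_diff (μ := μ) (s := H ∩ {ω | θ ω = i}) hZm
      rw [this, q1 2 (Or.inr rfl) 1 (Or.inr rfl) i hi] at e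
      simp only [if_true] at e
      simp only [hm] at e
      linarith
    exact ⟨hZ, by rw [hc 1 (Or.inl rfl)]; simp [signalProb],
      by rw [hc 2 (Or.inr rfl)]; simp [signalProb]⟩
end
end

section
/- For every λ ∈ [0,1] and every t ≥ 1, the conditional expectation E_1[(R_t/R_{t-1})^{−λ} | F_{t-1}] equals: (a^{1−λ} b^{λ}/(a+b))·p_t + (1 − (a/(a+b))p_t)^{1−λ}·(1 − (b/(a+b))p_t)^{λ} on the event {R_{t-1} < b/a}; (a^{1−λ} b^{λ} + a^{λ} b^{1−λ})/(a+b) on the event {R_{t-1} ∈ [b/a, a/b]}; and (a^{λ} b^{1−λ}/(a+b))·p_t + (1 − (b/(a+b))p_t)^{1−λ}·(1 − (a/(a+b))p_t)^{λ} on the event {R_{t-1} > a/b}. -/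
open MeasureTheory ProbabilityTheory Filter Asymptotics
open scoped ENNReal NNReal

noncomputable section

/-- Weight of the revealing indicator. -/
def qw (p : ℝ) (c : ℕ) : ℝ := if c = 1 then p else 1 - p

/-- Pattern of signals and indicators on a finite set of times. -/
def pat {Ω : Type*} (X I : ℕ → Ω → ℕ) (S : Finset ℕ) (ω : Ω) : S → Bool × Bool :=
  fun s => (decide (X s ω = 1), decide (I s ω = 1))

section aux
variable {a b : ℝ} {p : ℕ → ℝ} {Ω : Type*} [MeasurableSpace Ω] {μ : Measure Ω} {θ : Ω → ℕ}
  {X I Z : ℕ → Ω → ℕ}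

lemma pat_meas (hC : IsCascade a b p μ θ X I Z) (S : Finset ℕ) : Measurable (pat X I S) := by
  refine measurable_pi_lambda _ fun s => ?_
  refine Measurable.prodMk ?_ ?_
  · exact (measurable_from_top (f := fun n : ℕ => decide (n = 1))).comp (hC.X_meas s)
  · exact (measurable_from_top (f := fun n : ℕ => decide (n = 1))).comp (hC.I_meas s)

lemma sum_pat (hC : IsCascade a b p μ θ X I Z) (S : Finset ℕ) (A : Set Ω) :
    μ.real A = ∑ π : S → Bool × Bool, μ.real (A ∩ pat X I S ⁻¹' {π}) := by
  have := hC.prob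
  have h := sum_measureReal_preimage_singleton (μ := μ.restrict A) (f := pat X I S)
    Finset.univ (fun y _ => pat_meas hC S (measurableSet_singleton y))
  simp only [Finset.coe_univ, Set.preimage_univ] at h
  rw [measureReal_restrict_apply MeasurableSet.univ, Set.univ_inter] at h
  rw [← h]
  refine Finset.sum_congr rfl fun π _ => ?_
  rw [measureReal_restrict_apply (pat_meas hC S (measurableSet_singleton π)), Set.inter_comm]

lemma joint_ext (hC : IsCascade a b p μ θ X I Z) (S : Finset ℕ) (hS : ∀ s ∈ S, 1 ≤ s)
    (t : ℕ) (ht : 1 ≤ t) (htS : t ∉ S) (H : Set Ω)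
    (hH : ∀ ω ω', (∀ s ∈ S, X s ω = X s ω' ∧ I s ω = I s ω') → ω ∈ H → ω' ∈ H)
    (i : ℕ) (hi : i = 1 ∨ i = 2) (x c : ℕ) (hx : x = 1 ∨ x = 2) (hc : c = 0 ∨ c = 1) :
    μ.real {ω | θ ω = i ∧ ω ∈ H ∧ X t ω = x ∧ I t ω = c}
      = μ.real {ω | θ ω = i ∧ ω ∈ H} * (signalProb a b i x * qw (p t) c) := by
  have := hC.prob
  rw [sum_pat hC S, sum_pat hC S {ω | θ ω = i ∧ ω ∈ H}, Finset.sum_mul]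
  refine Finset.sum_congr rfl fun π _ => ?_
  by_cases hne : ∃ ω1 ∈ H, pat X I S ω1 = π
  · obtain ⟨ω1, h1H, h1⟩ := hne
    have hpat : ∀ ω, pat X I S ω = π ↔ ∀ s ∈ S, X s ω = X s ω1 ∧ I s ω = I s ω1 := by
      intro ω
      rw [← h1]
      constructor
      · intro h s hs
        have := congrFun h ⟨s, hs⟩
        simp only [pat, Prod.mk.injEq, decide_eq_decide] at this
        have e1 := hC.X_range s ω
        have e2 := hC.X_range s ω1
        have e3 := hC.I_range s ω
        have e4 := hC.I_range s ω1
        omega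
      · intro h
        funext s
        simp [pat, h s.1 s.2]
    have hj1 := hC.joint i hi S hS (fun s => X s ω1) (fun s => I s ω1)
      (fun s => hC.X_range s ω1) (fun s => hC.I_range s ω1)
    have hj2 := hC.joint i hi (insert t S) (by
        intro s hs
        rcases Finset.mem_insert.1 hs with rfl | h
        · exact ht
        · exact hS _ h)
      (fun s => if s = t then x else X s ω1) (fun s => if s = t then c else I s ω1)
      (fun s => by split_ifs; exacts [hx, hC.X_range s ω1])
      (fun s => by split_ifs; exacts [hc, hC.I_range s ω1])
    rw [Finset.prod_insert htS] at hj2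
    have hprod : (∏ s ∈ S, signalProb a b i (if s = t then x else X s ω1) *
        (if (if s = t then c else I s ω1) = 1 then p s else 1 - p s))
        = ∏ s ∈ S, signalProb a b i (X s ω1) * (if I s ω1 = 1 then p s else 1 - p s) := by
      refine Finset.prod_congr rfl fun s hs => ?_
      have : s ≠ t := fun h => htS (h ▸ hs)
      simp [this]
    rw [hprod] at hj2
    have s1 : {ω | θ ω = i ∧ ω ∈ H} ∩ pat X I S ⁻¹' {π}
        = {ω | θ ω = i ∧ ∀ s ∈ S, X s ω = X s ω1 ∧ I s ω = I s ω1} := by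
      ext ω
      simp only [Set.mem_inter_iff, Set.mem_ofPred_eq, Set.mem_preimage, Set.mem_singleton_iff, hpat]
      constructor
      · rintro ⟨⟨h, -⟩, h'⟩; exact ⟨h, h'⟩
      · rintro ⟨h, h'⟩
        exact ⟨⟨h, hH ω1 ω (fun s hs => ⟨(h' s hs).1.symm, (h' s hs).2.symm⟩) h1H⟩, h'⟩
    have s2 : {ω | θ ω = i ∧ ω ∈ H ∧ X t ω = x ∧ I t ω = c} ∩ pat X I S ⁻¹' {π}
        = {ω | θ ω = i ∧ ∀ s ∈ insert t S, X s ω = (if s = t then x else X s ω1) ∧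
            I s ω = (if s = t then c else I s ω1)} := by
      ext ω
      simp only [Set.mem_inter_iff, Set.mem_ofPred_eq, Set.mem_preimage, Set.mem_singleton_iff, hpat,
        Finset.forall_mem_insert, if_true]
      have hSne : ∀ s ∈ S, s ≠ t := fun s hs h => htS (h ▸ hs)
      constructor
      · rintro ⟨⟨h, -, h2⟩, h'⟩
        refine ⟨h, h2, fun s hs => ?_⟩
        simpa [hSne s hs] using h' s hs
      · rintro ⟨h, h2, h'⟩
        have h'' : ∀ s ∈ S, X s ω = X s ω1 ∧ I s ω = I s ω1 := fun s hs => by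
          simpa [hSne s hs] using h' s hs
        exact ⟨⟨h, hH ω1 ω (fun s hs => ⟨(h'' s hs).1.symm, (h'' s hs).2.symm⟩) h1H, h2⟩, h''⟩
    rw [s1, s2, measureReal_def, measureReal_def, hj1, hj2]
    simp only [if_true, qw]
    ring
  · push Not at hne
    have e1 : {ω | θ ω = i ∧ ω ∈ H} ∩ pat X I S ⁻¹' {π} = ∅ := by
      ext ω; simp; intro _ h; exact hne ω h
    have e2 : {ω | θ ω = i ∧ ω ∈ H ∧ X t ω = x ∧ I t ω = c} ∩ pat X I S ⁻¹' {π} = ∅ := by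
      ext ω; simp; intro _ h _ _; exact hne ω h
    rw [e1, e2]; simp

lemma Z_det (hC : IsCascade a b p μ θ X I Z) (n : ℕ) (ω ω' : Ω)
    (h : ∀ s ∈ Finset.Icc 1 n, X s ω = X s ω' ∧ I s ω = I s ω') :
    ∀ s ∈ Finset.Icc 1 n, Z s ω = Z s ω' := by
  intro s
  induction s using Nat.strong_induction_on with
  | _ s ih =>
    intro hs
    have hs' := Finset.mem_Icc.1 hs
    have hZ : ∀ r ∈ Finset.Icc 1 (s - 1), Z r ω = Z r ω' := by
      intro r hr
      have := Finset.mem_Icc.1 hr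
      exact ih r (by omega) (Finset.mem_Icc.2 (by omega))
    have hD : ∀ i, Dlike μ θ X Z s i ω = Dlike μ θ X Z s i ω' := by
      intro i
      unfold Dlike
      congr 3
      ext v
      simp only [Set.mem_ofPred_eq, (h s hs).1]
      constructor
      · rintro ⟨h1, h2, h3⟩; exact ⟨h1, fun r hr => (h2 r hr).trans (hZ r hr), h3⟩
      · rintro ⟨h1, h2, h3⟩; exact ⟨h1, fun r hr => (h2 r hr).trans (hZ r hr).symm, h3⟩
    rw [hC.dynamics s hs'.1 ω, hC.dynamics s hs'.1 ω']
    simp only [mapEst, hD, (h s hs).1, (h s hs).2]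

/-- history event -/
def Hist (Z : ℕ → Ω → ℕ) (n : ℕ) (ω0 : Ω) : Set Ω :=
  {ω | ∀ s ∈ Finset.Icc 1 n, Z s ω = Z s ω0}

lemma Hist_meas (hC : IsCascade a b p μ θ X I Z) (n : ℕ) (ω0 : Ω) :
    MeasurableSet (Hist Z n ω0) := by
  have : Hist Z n ω0 = ⋂ s ∈ Finset.Icc 1 n, Z s ⁻¹' {Z s ω0} := by
    ext ω; simp [Hist]
  rw [this]
  exact Finset.measurableSet_biInter _ fun s _ => hC.Z_meas s (measurableSet_singleton _)

lemma joint_H (hC : IsCascade a b p μ θ X I Z) (n : ℕ) (ω0 : Ω)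
    (i : ℕ) (hi : i = 1 ∨ i = 2) (x c : ℕ) (hx : x = 1 ∨ x = 2) (hc : c = 0 ∨ c = 1) :
    μ.real {ω | θ ω = i ∧ ω ∈ Hist Z n ω0 ∧ X (n+1) ω = x ∧ I (n+1) ω = c}
      = μ.real {ω | θ ω = i ∧ ω ∈ Hist Z n ω0} * (signalProb a b i x * qw (p (n+1)) c) := by
  refine joint_ext hC (Finset.Icc 1 n) (fun s hs => (Finset.mem_Icc.1 hs).1) (n+1) (by omega)
    (by simp) _ ?_ i hi x c hx hc
  intro ω ω' h hω s hs
  rw [← Z_det hC n ω ω' h s hs]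
  exact hω s hs

/-- four-way split of an event by the current signal and indicator -/
lemma split4 (hC : IsCascade a b p μ θ X I Z) (t : ℕ) (A : Set Ω) :
    μ.real A = μ.real (A ∩ {ω | X t ω = 1 ∧ I t ω = 0}) + μ.real (A ∩ {ω | X t ω = 1 ∧ I t ω = 1})
     + μ.real (A ∩ {ω | X t ω = 2 ∧ I t ω = 0}) + μ.real (A ∩ {ω | X t ω = 2 ∧ I t ω = 1}) := by
  have := hC.prob
  have hX : MeasurableSet {ω | X t ω = 1} := hC.X_meas t (measurableSet_singleton _)
  have hI : MeasurableSet {ω | I t ω = 0} := hC.I_meas t (measurableSet_singleton _)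
  rw [← measureReal_inter_add_sdiff (s := A) hX, ← measureReal_inter_add_sdiff (s := A ∩ _) hI,
    ← measureReal_inter_add_sdiff (s := A \ _) hI, ← add_assoc]
  congr 1
  · congr 1
    · congr 1
      all_goals
        congr 1
        ext ω
        have e1 := hC.X_range t ω
        have e2 := hC.I_range t ω
        simp only [Set.mem_inter_iff, Set.mem_sdiff, Set.mem_ofPred_eq]
        grind
    · congr 1
      ext ω
      have e1 := hC.X_range t ω
      have e2 := hC.I_range t ω
      simp only [Set.mem_inter_iff, Set.mem_sdiff, Set.mem_ofPred_eq]
      grind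
  · congr 1
    ext ω
    have e1 := hC.X_range t ω
    have e2 := hC.I_range t ω
    simp only [Set.mem_inter_iff, Set.mem_sdiff, Set.mem_ofPred_eq]
    grind

lemma Dlike_eq (hC : IsCascade a b p μ θ X I Z) (n : ℕ) (ω0 ω : Ω) (hω : ω ∈ Hist Z n ω0)
    (i : ℕ) (hi : i = 1 ∨ i = 2) :
    Dlike μ θ X Z (n+1) i ω = (μ.real {ω | θ ω = i ∧ ω ∈ Hist Z n ω0} *
      signalProb a b i (X (n+1) ω)) / μ.real {ω | θ ω = i} := by
  have := hC.prob
  unfold Dlike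
  rw [← measureReal_def, ← measureReal_def]
  congr 1
  have hI : MeasurableSet {ω | I (n+1) ω = 0} := hC.I_meas _ (measurableSet_singleton _)
  rw [← measureReal_inter_add_sdiff hI]
  have j0 := joint_H hC n ω0 i hi (X (n+1) ω) 0 (hC.X_range _ _) (by simp)
  have j1 := joint_H hC n ω0 i hi (X (n+1) ω) 1 (hC.X_range _ _) (by simp)
  have hh : ∀ v, (∀ s ∈ Finset.Icc 1 n, Z s v = Z s ω) ↔ v ∈ Hist Z n ω0 := by
    intro v
    constructor
    · intro h s hs; rw [h s hs]; exact hω s hs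
    · intro h s hs; rw [h s hs]; exact (hω s hs).symm
  have t0 : {ω' | θ ω' = i ∧ (∀ s ∈ Finset.Icc 1 (n + 1 - 1), Z s ω' = Z s ω) ∧
      X (n+1) ω' = X (n+1) ω} ∩ {ω | I (n+1) ω = 0}
      = {v | θ v = i ∧ v ∈ Hist Z n ω0 ∧ X (n+1) v = X (n+1) ω ∧ I (n+1) v = 0} := by
    ext v
    simp only [Nat.add_sub_cancel, hh, Set.mem_inter_iff, Set.mem_ofPred_eq]
    tauto
  have t1 : {ω' | θ ω' = i ∧ (∀ s ∈ Finset.Icc 1 (n + 1 - 1), Z s ω' = Z s ω) ∧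
      X (n+1) ω' = X (n+1) ω} \ {ω | I (n+1) ω = 0}
      = {v | θ v = i ∧ v ∈ Hist Z n ω0 ∧ X (n+1) v = X (n+1) ω ∧ I (n+1) v = 1} := by
    ext v
    have := hC.I_range (n+1) v
    simp only [Nat.add_sub_cancel, hh, Set.mem_sdiff, Set.mem_ofPred_eq]
    grind
  rw [t0, t1, j0, j1]
  simp [qw]; ring

/-- conditional action probability -/
def kk (a b p : ℝ) (g : ℕ → ℕ) (i z : ℕ) : ℝ :=
  (if g 1 = z then signalProb a b i 1 * (1 - p) else 0) +
  (if 1 = z then signalProb a b i 1 * p else 0) +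
  (if g 2 = z then signalProb a b i 2 * (1 - p) else 0) +
  (if 2 = z then signalProb a b i 2 * p else 0)

lemma action_prob (hC : IsCascade a b p μ θ X I Z) (n : ℕ) (ω0 : Ω) (g : ℕ → ℕ)
    (hg : ∀ ω ∈ Hist Z n ω0, mapEst μ θ X Z (n+1) ω = g (X (n+1) ω))
    (i : ℕ) (hi : i = 1 ∨ i = 2) (z : ℕ) :
    μ.real {ω | θ ω = i ∧ ω ∈ Hist Z n ω0 ∧ Z (n+1) ω = z}
      = μ.real {ω | θ ω = i ∧ ω ∈ Hist Z n ω0} * kk a b (p (n+1)) g i z := by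
  have := hC.prob
  have key : ∀ x c, (x = 1 ∨ x = 2) → (c = 0 ∨ c = 1) →
      μ.real ({ω | θ ω = i ∧ ω ∈ Hist Z n ω0 ∧ Z (n+1) ω = z} ∩
        {ω | X (n+1) ω = x ∧ I (n+1) ω = c})
      = μ.real {ω | θ ω = i ∧ ω ∈ Hist Z n ω0} *
        (if (if c = 1 then x else g x) = z then signalProb a b i x * qw (p (n+1)) c else 0) := by
    intro x c hx hc
    have hz : ∀ ω ∈ Hist Z n ω0, X (n+1) ω = x → I (n+1) ω = c →
        Z (n+1) ω = if c = 1 then x else g x := by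
      intro ω hω h1 h2
      rw [hC.dynamics (n+1) (by omega) ω, hg ω hω, h1, h2]
    split_ifs with h h' h'
    all_goals
      first
      | rw [← joint_H hC n ω0 i hi x c hx hc]
        congr 1
        ext ω
        have := hz ω
        simp only [Set.mem_inter_iff, Set.mem_ofPred_eq]
        grind
      | rw [mul_zero]
        convert measureReal_empty (μ := μ)
        ext ω
        have := hz ω
        simp only [Set.mem_inter_iff, Set.mem_ofPred_eq, Set.mem_empty_iff_false, iff_false]
        grind
  rw [split4 hC (n+1), key 1 0 (by simp) (by simp), key 1 1 (by simp) (by simp),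
    key 2 0 (by simp) (by simp), key 2 1 (by simp) (by simp)]
  simp only [kk, qw, mul_add, zero_ne_one, if_true, if_false]

lemma theta_half (hC : IsCascade a b p μ θ X I Z) (i : ℕ) (hi : i = 1 ∨ i = 2) :
    μ.real {ω | θ ω = i} = 1 / 2 := by
  have := hC.joint i hi ∅ (by simp) (fun _ => 1) (fun _ => 0) (by simp) (by simp)
  simpa [measureReal_def] using this

lemma Hist_congr (n : ℕ) (ω0 ω : Ω) (hω : ω ∈ Hist Z n ω0) : Hist Z n ω = Hist Z n ω0 := by
  ext v
  constructor
  · intro h s hs; rw [h s hs]; exact hω s hs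
  · intro h s hs; rw [h s hs]; exact (hω s hs).symm

lemma Llike_eq (hC : IsCascade a b p μ θ X I Z) (n : ℕ) (ω0 ω : Ω) (hω : ω ∈ Hist Z n ω0)
    (i : ℕ) (hi : i = 1 ∨ i = 2) :
    Llike μ θ Z n i ω = 2 * μ.real {ω | θ ω = i ∧ ω ∈ Hist Z n ω0} := by
  unfold Llike
  rw [← measureReal_def, ← measureReal_def, theta_half hC i hi, ← Hist_congr n ω0 ω hω]
  simp only [Hist, Set.mem_ofPred_eq]
  ring

lemma Llike_succ (hC : IsCascade a b p μ θ X I Z) (n : ℕ) (ω0 ω : Ω) (hω : ω ∈ Hist Z n ω0)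
    (i : ℕ) (hi : i = 1 ∨ i = 2) :
    Llike μ θ Z (n+1) i ω = 2 * μ.real {v | θ v = i ∧ v ∈ Hist Z n ω0 ∧ Z (n+1) v = Z (n+1) ω} := by
  unfold Llike
  rw [← measureReal_def, ← measureReal_def, theta_half hC i hi, ← Hist_congr n ω0 ω hω]
  have : {ω' | θ ω' = i ∧ ∀ s ∈ Finset.Icc 1 (n + 1), Z s ω' = Z s ω}
      = {v | θ v = i ∧ v ∈ Hist Z n ω ∧ Z (n+1) v = Z (n+1) ω} := by
    ext v
    simp only [Hist, Set.mem_ofPred_eq, Finset.mem_Icc]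
    refine and_congr_right fun _ => ⟨fun h => ⟨fun s hs => h s (by omega), h _ (by omega)⟩, ?_⟩
    rintro ⟨h, h'⟩ s hs
    rcases Nat.lt_or_ge s (n+1) with h3 | h3
    · exact h s (by omega)
    · have : s = n + 1 := by omega
      rw [this]; exact h'
  rw [this]
  ring

lemma integral_eq (hC : IsCascade a b p μ θ X I Z) (n : ℕ) (ω0 : Ω) (g : ℕ → ℕ)
    (hg12 : ∀ x, g x = 1 ∨ g x = 2 ∨ (x ≠ 1 ∧ x ≠ 2))
    (hg : ∀ ω ∈ Hist Z n ω0, mapEst μ θ X Z (n+1) ω = g (X (n+1) ω))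
    (h1 : μ (Hist Z n ω0 ∩ {ω | θ ω = 1}) ≠ 0)
    (h2 : μ (Hist Z n ω0 ∩ {ω | θ ω = 2}) ≠ 0) (l : ℝ) :
    ∫ ω, (LR μ θ Z (n+1) ω / LR μ θ Z n ω) ^ (-l) ∂(μ[|Hist Z n ω0 ∩ {ω | θ ω = 1}])
      = kk a b (p (n+1)) g 1 1 * (kk a b (p (n+1)) g 1 1 / kk a b (p (n+1)) g 2 1) ^ (-l)
       + kk a b (p (n+1)) g 1 2 * (kk a b (p (n+1)) g 1 2 / kk a b (p (n+1)) g 2 2) ^ (-l) := by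
  have := hC.prob
  set k := kk a b (p (n+1)) g with hk
  set B := Hist Z n ω0 ∩ {ω | θ ω = 1} with hB
  have hBm : MeasurableSet B :=
    (Hist_meas hC n ω0).inter (hC.theta_meas (measurableSet_singleton 1))
  have hs : ∀ i, Hist Z n ω0 ∩ {ω | θ ω = i} = {ω | θ ω = i ∧ ω ∈ Hist Z n ω0} := by
    intro i; ext ω; simp [and_comm]
  have hM1 : μ.real {ω | θ ω = 1 ∧ ω ∈ Hist Z n ω0} ≠ 0 := by
    rw [← hs, measureReal_def, ENNReal.toReal_ne_zero]
    exact ⟨h1, measure_ne_top _ _⟩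
  have hM2 : μ.real {ω | θ ω = 2 ∧ ω ∈ Hist Z n ω0} ≠ 0 := by
    rw [← hs, measureReal_def, ENNReal.toReal_ne_zero]
    exact ⟨h2, measure_ne_top _ _⟩
  have hprob : IsProbabilityMeasure (μ[|B]) := cond_isProbabilityMeasure h1
  have hZ12 : ∀ ω ∈ Hist Z n ω0, Z (n+1) ω = 1 ∨ Z (n+1) ω = 2 := by
    intro ω hω
    have e := hC.X_range (n+1) ω
    have e' := hg12 (X (n+1) ω)
    rw [hC.dynamics (n+1) (by omega) ω, hg ω hω]
    split_ifs <;> omega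
  have hS : ∀ z, MeasurableSet {ω | Z (n+1) ω = z} := fun z =>
    hC.Z_meas (n+1) (measurableSet_singleton z)
  have hae : ∀ᵐ ω ∂(μ[|B]), (LR μ θ Z (n+1) ω / LR μ θ Z n ω) ^ (-l)
      = Set.indicator {ω | Z (n+1) ω = 1} (fun _ => (k 1 1 / k 2 1) ^ (-l)) ω
        + Set.indicator {ω | Z (n+1) ω = 2} (fun _ => (k 1 2 / k 2 2) ^ (-l)) ω := by
    filter_upwards [ae_cond_mem hBm] with ω hω
    have hlr : LR μ θ Z (n+1) ω / LR μ θ Z n ω = k 1 (Z (n+1) ω) / k 2 (Z (n+1) ω) := by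
      unfold LR
      rw [Llike_eq hC n ω0 ω hω.1 1 (by simp), Llike_eq hC n ω0 ω hω.1 2 (by simp),
        Llike_succ hC n ω0 ω hω.1 1 (by simp), Llike_succ hC n ω0 ω hω.1 2 (by simp),
        action_prob hC n ω0 g hg 1 (by simp), action_prob hC n ω0 g hg 2 (by simp), ← hk]
      field_simp
    rw [hlr]
    rcases hZ12 ω hω.1 with h | h <;> simp [Set.indicator, h]
  have hreal : ∀ z, (μ[|B]).real {ω | Z (n+1) ω = z} = k 1 z := by
    intro z
    rw [measureReal_def, cond_apply hBm, ENNReal.toReal_mul, ENNReal.toReal_inv, ← measureReal_def,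
      ← measureReal_def]
    have : B ∩ {ω | Z (n+1) ω = z} = {ω | θ ω = 1 ∧ ω ∈ Hist Z n ω0 ∧ Z (n+1) ω = z} := by
      ext ω; simp [hB]; tauto
    rw [this, action_prob hC n ω0 g hg 1 (by simp), hB, hs, hk]
    field_simp
  rw [integral_congr_ae hae, integral_add ((integrable_const _).indicator (hS 1))
    ((integrable_const _).indicator (hS 2)), integral_indicator_const _ (hS 1),
    integral_indicator_const _ (hS 2), hreal, hreal]
  simp

lemma mapEst_eq (hC : IsCascade a b p μ θ X I Z) (n : ℕ) (ω0 ω : Ω) (hω : ω ∈ Hist Z n ω0) :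
    mapEst μ θ X Z (n+1) ω =
      (if μ.real {ω | θ ω = 2 ∧ ω ∈ Hist Z n ω0} * signalProb a b 2 (X (n+1) ω)
        < μ.real {ω | θ ω = 1 ∧ ω ∈ Hist Z n ω0} * signalProb a b 1 (X (n+1) ω) then 1
      else if μ.real {ω | θ ω = 1 ∧ ω ∈ Hist Z n ω0} * signalProb a b 1 (X (n+1) ω)
        < μ.real {ω | θ ω = 2 ∧ ω ∈ Hist Z n ω0} * signalProb a b 2 (X (n+1) ω) then 2
      else X (n+1) ω) := by
  unfold mapEst
  rw [Dlike_eq hC n ω0 ω hω 1 (by simp), Dlike_eq hC n ω0 ω hω 2 (by simp),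
    theta_half hC 1 (by simp), theta_half hC 2 (by simp)]
  simp only [div_lt_div_iff_of_pos_right (show (0:ℝ) < 1/2 by norm_num)]

lemma pow_id {x y l : ℝ} (hx : 0 < x) (hy : 0 < y) :
    x * (x / y) ^ (-l) = x ^ (1 - l) * y ^ l := by
  rw [Real.div_rpow hx.le hy.le, Real.rpow_neg hx.le, Real.rpow_neg hy.le,
    Real.rpow_sub hx, Real.rpow_one]
  have := (Real.rpow_pos_of_pos hx l).ne'
  have := (Real.rpow_pos_of_pos hy l).ne'
  field_simp

lemma pow_id_p {x y l c p : ℝ} (hx : 0 < x) (hy : 0 < y) (hc : 0 < c) :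
    x / c * p * (x / c * p / (y / c * p)) ^ (-l) = x ^ (1 - l) * y ^ l / c * p := by
  by_cases hp : p = 0
  · simp [hp]
  · have : x / c * p / (y / c * p) = x / y := by field_simp
    rw [this, ← pow_id hx hy]
    ring
end aux

/-- For every `λ ∈ [0,1]` and `t ≥ 1`, the conditional expectation
`E_1[(R_t/R_{t-1})^{−λ} | F_{t-1}]` (here: the expectation under `P(· | θ = 1, history)`,
where the history is the event of agreeing with a reference point `ω0` on the first `t-1`
actions, assumed to have positive probability together with `{θ = 1}` and `{θ = 2}`)
equals
`(a^{1−λ}b^{λ}/(a+b))·p_t + (1 − (a/(a+b))p_t)^{1−λ}·(1 − (b/(a+b))p_t)^{λ}` when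
`R_{t-1} < b/a`; `(a^{1−λ}b^{λ} + a^{λ}b^{1−λ})/(a+b)` when `R_{t-1} ∈ [b/a, a/b]`; and
`(a^{λ}b^{1−λ}/(a+b))·p_t + (1 − (b/(a+b))p_t)^{1−λ}·(1 − (a/(a+b))p_t)^{λ}` when
`R_{t-1} > a/b`. -/
theorem conditional_expectation_ratio (a b : ℝ) (hb : 0 < b) (hab : b < a)
    (p : ℕ → ℝ) {Ω : Type*} [MeasurableSpace Ω] (μ : Measure Ω) (θ : Ω → ℕ)
    (X I Z : ℕ → Ω → ℕ) (hC : IsCascade a b p μ θ X I Z)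
    (l : ℝ) (hl : l ∈ Set.Icc (0 : ℝ) 1) (t : ℕ) (ht : 1 ≤ t) (ω0 : Ω)
    (h1 : μ ({ω | ∀ s ∈ Finset.Icc 1 (t - 1), Z s ω = Z s ω0} ∩ {ω | θ ω = 1}) ≠ 0)
    (h2 : μ ({ω | ∀ s ∈ Finset.Icc 1 (t - 1), Z s ω = Z s ω0} ∩ {ω | θ ω = 2}) ≠ 0) :
    (LR μ θ Z (t - 1) ω0 < b / a →
      ∫ ω, (LR μ θ Z t ω / LR μ θ Z (t - 1) ω) ^ (-l)
          ∂(μ[|{ω | ∀ s ∈ Finset.Icc 1 (t - 1), Z s ω = Z s ω0} ∩ {ω | θ ω = 1}])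
        = a ^ (1 - l) * b ^ l / (a + b) * p t
            + (1 - a / (a + b) * p t) ^ (1 - l) * (1 - b / (a + b) * p t) ^ l) ∧
    (LR μ θ Z (t - 1) ω0 ∈ Set.Icc (b / a) (a / b) →
      ∫ ω, (LR μ θ Z t ω / LR μ θ Z (t - 1) ω) ^ (-l)
          ∂(μ[|{ω | ∀ s ∈ Finset.Icc 1 (t - 1), Z s ω = Z s ω0} ∩ {ω | θ ω = 1}])
        = (a ^ (1 - l) * b ^ l + a ^ l * b ^ (1 - l)) / (a + b)) ∧
    (a / b < LR μ θ Z (t - 1) ω0 →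
      ∫ ω, (LR μ θ Z t ω / LR μ θ Z (t - 1) ω) ^ (-l)
          ∂(μ[|{ω | ∀ s ∈ Finset.Icc 1 (t - 1), Z s ω = Z s ω0} ∩ {ω | θ ω = 1}])
        = a ^ l * b ^ (1 - l) / (a + b) * p t
            + (1 - b / (a + b) * p t) ^ (1 - l) * (1 - a / (a + b) * p t) ^ l) := by
  obtain ⟨n, rfl⟩ : ∃ n, t = n + 1 := ⟨t - 1, by omega⟩
  have := hC.prob
  have ha : 0 < a := hb.trans hab
  have hc : 0 < a + b := by linarith
  simp only [Nat.add_sub_cancel] at *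
  change μ (Hist Z n ω0 ∩ {ω | θ ω = 1}) ≠ 0 at h1
  change μ (Hist Z n ω0 ∩ {ω | θ ω = 2}) ≠ 0 at h2
  change (_ → ∫ ω, _ ∂(μ[|Hist Z n ω0 ∩ {ω | θ ω = 1}]) = _) ∧
    (_ → ∫ ω, _ ∂(μ[|Hist Z n ω0 ∩ {ω | θ ω = 1}]) = _) ∧
    (_ → ∫ ω, _ ∂(μ[|Hist Z n ω0 ∩ {ω | θ ω = 1}]) = _)
  have hs : ∀ i, Hist Z n ω0 ∩ {ω | θ ω = i} = {ω | θ ω = i ∧ ω ∈ Hist Z n ω0} := by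
    intro i; ext ω; simp [and_comm]
  have hM1 : 0 < μ.real {ω | θ ω = 1 ∧ ω ∈ Hist Z n ω0} := by
    rw [← hs, measureReal_def]
    exact ENNReal.toReal_pos h1 (measure_ne_top _ _)
  have hM2 : 0 < μ.real {ω | θ ω = 2 ∧ ω ∈ Hist Z n ω0} := by
    rw [← hs, measureReal_def]
    exact ENNReal.toReal_pos h2 (measure_ne_top _ _)
  have hmem : ω0 ∈ Hist Z n ω0 := fun _ _ => rfl
  have hLR : LR μ θ Z n ω0 = μ.real {ω | θ ω = 1 ∧ ω ∈ Hist Z n ω0} /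
      μ.real {ω | θ ω = 2 ∧ ω ∈ Hist Z n ω0} := by
    unfold LR
    rw [Llike_eq hC n ω0 ω0 hmem 1 (by simp), Llike_eq hC n ω0 ω0 hmem 2 (by simp)]
    field_simp
  have hmap := mapEst_eq hC n ω0
  have hint := integral_eq hC n ω0
  rw [hLR]
  generalize μ.real {ω | θ ω = 1 ∧ ω ∈ Hist Z n ω0} = M1 at *
  generalize μ.real {ω | θ ω = 2 ∧ ω ∈ Hist Z n ω0} = M2 at *
  have hp := hC.p_mem (n+1) (by omega)
  have hd : a / (a + b) = 1 - b / (a + b) := by field_simp; ring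
  have hbp : 0 < b / (a + b) := by positivity
  have hap : 0 < a / (a + b) := by positivity
  have hpa : 0 < 1 - a / (a + b) * p (n+1) := by nlinarith [hp.1, hp.2]
  have hpb : 0 < 1 - b / (a + b) * p (n+1) := by nlinarith [hp.1, hp.2]
  refine ⟨fun hR => ?_, fun hR => ?_, fun hR => ?_⟩
  · rw [div_lt_div_iff₀ hM2 ha] at hR
    rw [hint (fun _ => 2) (by simp) ?_ h1 h2 l]
    · have e11 : kk a b (p (n+1)) (fun _ => 2) 1 1 = a / (a + b) * p (n+1) := by
        simp [kk, signalProb]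
      have e21 : kk a b (p (n+1)) (fun _ => 2) 2 1 = b / (a + b) * p (n+1) := by
        simp [kk, signalProb]
      have e12 : kk a b (p (n+1)) (fun _ => 2) 1 2 = 1 - a / (a + b) * p (n+1) := by
        simp [kk, signalProb]; rw [hd]; ring
      have e22 : kk a b (p (n+1)) (fun _ => 2) 2 2 = 1 - b / (a + b) * p (n+1) := by
        simp [kk, signalProb]; rw [hd]; ring
      rw [e11, e21, e12, e22, pow_id_p ha hb hc, pow_id hpa hpb]
    · intro ω hω
      rw [hmap ω hω]
      rcases hC.X_range (n+1) ω with h | h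
      · have : M1 * (a / (a+b)) < M2 * (b / (a+b)) := by
          rw [mul_div_assoc', mul_div_assoc']; gcongr ?_ / _; linarith
        simp [h, signalProb, this, this.le]
      · have : M1 * (b / (a+b)) < M2 * (a / (a+b)) := by
          rw [mul_div_assoc', mul_div_assoc']; gcongr ?_ / _; nlinarith
        simp [h, signalProb, this, this.le]
  · obtain ⟨hR1, hR2⟩ := hR
    rw [div_le_div_iff₀ ha hM2] at hR1
    rw [div_le_div_iff₀ hM2 hb] at hR2
    rw [hint (fun x => x) (by intro x; omega) ?_ h1 h2 l]
    · have e11 : kk a b (p (n+1)) (fun x => x) 1 1 = a / (a + b) := by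
        simp [kk, signalProb]; ring
      have e21 : kk a b (p (n+1)) (fun x => x) 2 1 = b / (a + b) := by
        simp [kk, signalProb]; ring
      have e12 : kk a b (p (n+1)) (fun x => x) 1 2 = b / (a + b) := by
        simp [kk, signalProb]; ring
      have e22 : kk a b (p (n+1)) (fun x => x) 2 2 = a / (a + b) := by
        simp [kk, signalProb]; ring
      have q1 := pow_id_p (l := l) (p := 1) ha hb hc
      have q2 := pow_id_p (l := l) (p := 1) hb ha hc
      simp only [mul_one] at q1 q2
      rw [e11, e21, e12, e22, q1, q2]
      ring
    · intro ω hω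
      rw [hmap ω hω]
      rcases hC.X_range (n+1) ω with h | h
      · have : M2 * (b / (a+b)) ≤ M1 * (a / (a+b)) := by
          rw [mul_div_assoc', mul_div_assoc']; gcongr ?_ / _; linarith
        simp [h, signalProb, this.not_gt]
      · have : M1 * (b / (a+b)) ≤ M2 * (a / (a+b)) := by
          rw [mul_div_assoc', mul_div_assoc']; gcongr ?_ / _; linarith
        simp [h, signalProb, this.not_gt]
  · rw [div_lt_div_iff₀ hb hM2] at hR
    rw [hint (fun _ => 1) (by simp) ?_ h1 h2 l]
    · have e11 : kk a b (p (n+1)) (fun _ => 1) 1 1 = 1 - b / (a + b) * p (n+1) := by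
        simp [kk, signalProb]; rw [hd]; ring
      have e21 : kk a b (p (n+1)) (fun _ => 1) 2 1 = 1 - a / (a + b) * p (n+1) := by
        simp [kk, signalProb]; rw [hd]; ring
      have e12 : kk a b (p (n+1)) (fun _ => 1) 1 2 = b / (a + b) * p (n+1) := by
        simp [kk, signalProb]
      have e22 : kk a b (p (n+1)) (fun _ => 1) 2 2 = a / (a + b) * p (n+1) := by
        simp [kk, signalProb]
      rw [e11, e21, e12, e22, pow_id_p hb ha hc, pow_id hpb hpa]
      ring
    · intro ω hω
      rw [hmap ω hω]
      rcases hC.X_range (n+1) ω with h | h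
      · have : M2 * (b / (a+b)) < M1 * (a / (a+b)) := by
          rw [mul_div_assoc', mul_div_assoc']; gcongr ?_ / _; nlinarith
        simp [h, signalProb, this]
      · have : M2 * (a / (a+b)) < M1 * (b / (a+b)) := by
          rw [mul_div_assoc', mul_div_assoc']; gcongr ?_ / _; linarith
        simp [h, signalProb, this]
end
end

section
/- For reals a > b > 0, the function λ ↦ f_λ(a,b) := (λa + (1−λ)b − a^λ b^{1−λ})/(a+b) is concave and nonnegative on [0,1], vanishes at λ = 0 and λ = 1, attains its maximum on [0,1] at λ*(a,b) := log((a/b − 1)/log(a/b))/log(a/b), and its maximum value is f_{λ*}(a,b) = (b/(a+b))·(1/κ*(a,b)). -/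
noncomputable section

/-- `f_λ(a,b) = (λa + (1−λ)b − a^λ b^{1−λ}) / (a+b)`. -/
def fFun (a b l : ℝ) : ℝ :=
  (l * a + (1 - l) * b - a ^ l * b ^ (1 - l)) / (a + b)

/-- `λ*(a,b) = log((a/b − 1)/log(a/b)) / log(a/b)`. -/
def lambdaStar (a b : ℝ) : ℝ :=
  Real.log ((a / b - 1) / Real.log (a / b)) / Real.log (a / b)

theorem fFun_eq_aux (a b l : ℝ) (hb : 0 < b) (hab : b < a) :
    fFun a b l = b / (a + b) * (1 + l * (a / b - 1) - Real.exp (Real.log (a / b) * l)) := by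
  have ha : 0 < a := hb.trans hab
  have e : a ^ l * b ^ (1 - l) = b * Real.exp (Real.log (a / b) * l) := by
    rw [← Real.rpow_def_of_pos (div_pos ha hb), Real.div_rpow ha.le hb.le,
      Real.rpow_sub hb, Real.rpow_one]
    ring
  unfold fFun
  rw [e]
  have : a + b ≠ 0 := by positivity
  field_simp
  ring

/-- For `a > b > 0`, the function `λ ↦ f_λ(a,b)` is concave and
nonnegative on `[0,1]`, vanishes at `λ = 0` and `λ = 1`, attains its maximum on `[0,1]`
at `λ*(a,b)`, and its maximum value is `f_{λ*}(a,b) = (b/(a+b))·(1/κ*(a,b))`. -/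
theorem fFun_properties (a b : ℝ) (hb : 0 < b) (hab : b < a) :
    ConcaveOn ℝ (Set.Icc (0 : ℝ) 1) (fun l => fFun a b l) ∧
    (∀ l ∈ Set.Icc (0 : ℝ) 1, 0 ≤ fFun a b l) ∧
    fFun a b 0 = 0 ∧ fFun a b 1 = 0 ∧
    lambdaStar a b ∈ Set.Icc (0 : ℝ) 1 ∧
    (∀ l ∈ Set.Icc (0 : ℝ) 1, fFun a b l ≤ fFun a b (lambdaStar a b)) ∧
    fFun a b (lambdaStar a b) = b / (a + b) * (1 / kappaStar a b) := by
  have ha : 0 < a := hb.trans hab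
  have ht : 1 < a / b := (one_lt_div hb).2 hab
  have hc : 0 ≤ b / (a + b) := by positivity
  have heq := fun l => fFun_eq_aux a b l hb hab
  have hk : b / (a + b) * (1 / kappaStar a b) = b / (a + b) *
      (1 + (a / b - 1) / Real.log (a / b) *
      (Real.log ((a / b - 1) / Real.log (a / b)) - 1)) := by
    unfold kappaStar
    rw [one_div_one_div]
  rw [hk]
  have hls : lambdaStar a b =
    Real.log ((a / b - 1) / Real.log (a / b)) / Real.log (a / b) := rfl
  have htexp : Real.exp (Real.log (a / b)) = a / b := Real.exp_log (by positivity)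
  have hL : 0 < Real.log (a / b) := Real.log_pos ht
  have h1 : Real.log (a / b) ≤ a / b - 1 := Real.log_le_sub_one_of_pos (by positivity)
  have h2 : 1 - (a / b)⁻¹ ≤ Real.log (a / b) := Real.one_sub_inv_le_log_of_pos (by positivity)
  simp only [heq]
  generalize lambdaStar a b = s at *
  generalize b / (a + b) = c at *
  generalize a / b = t at *
  generalize Real.log t = L at *
  have hm1 : 1 ≤ (t - 1) / L := (one_le_div hL).2 h1
  have hmt : (t - 1) / L ≤ t := by
    rw [div_le_iff₀ hL]
    have h3 := mul_le_mul_of_nonneg_left h2 (by linarith : (0:ℝ) ≤ t)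
    rw [mul_sub, mul_inv_cancel₀ (by linarith)] at h3
    linarith
  have hmL : (t - 1) / L * L = t - 1 := div_mul_cancel₀ _ hL.ne'
  generalize (t - 1) / L = m at *
  have hsL : L * s = Real.log m := by rw [hls]; field_simp
  have hem : Real.exp (L * s) = m := by rw [hsL, Real.exp_log (by linarith)]
  refine ⟨?_, ?_, by simp, by simp [htexp], ?_, ?_, ?_⟩
  · refine ⟨convex_Icc 0 1, ?_⟩
    intro x _ y _ p q hp hq hpq
    have h := convexOn_exp.2 (Set.mem_univ (L * x)) (Set.mem_univ (L * y)) hp hq hpq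
    simp only [smul_eq_mul] at h ⊢
    have e : L * (p * x + q * y) = p * (L * x) + q * (L * y) := by ring
    rw [e]
    have h' := mul_le_mul_of_nonneg_left h hc
    have e2 : c = c * (p + q) := by rw [hpq, mul_one]
    have e3 : c * (1 + (p * x + q * y) * (t - 1) - Real.exp (p * (L * x) + q * (L * y)))
      = c * (p + q) + c * ((p * x + q * y) * (t - 1))
        - c * Real.exp (p * (L * x) + q * (L * y)) := by rw [← e2]; ring
    rw [e3]
    linarith
  · intro l hl
    have h := convexOn_exp.2 (Set.mem_univ L) (Set.mem_univ 0) hl.1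
      (sub_nonneg.2 hl.2) (by ring)
    simp only [smul_eq_mul, mul_zero, add_zero, htexp, Real.exp_zero] at h
    rw [mul_comm l L] at h
    apply mul_nonneg hc
    linarith
  · rw [hls]
    refine ⟨div_nonneg (Real.log_nonneg hm1) hL.le, (div_le_one hL).2 ?_⟩
    rw [Real.log_le_iff_le_exp (by linarith), htexp]
    exact hmt
  · intro l _
    apply mul_le_mul_of_nonneg_left _ hc
    have h := Real.add_one_le_exp (L * l - L * s)
    have e : Real.exp (L * l) = m * Real.exp (L * l - L * s) := by
      rw [← hem, ← Real.exp_add]; congr 1; ring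
    rw [e, hem, ← hmL]
    have := mul_le_mul_of_nonneg_left h (by linarith : (0:ℝ) ≤ m)
    linarith
  · rw [hem, ← hmL, ← hsL]
    ring
end
end

section
/- For all reals a > b > 0, the quantity λ*(a,b) := log((a/b − 1)/log(a/b))/log(a/b) satisfies 1/2 < λ*(a,b) < 1. -/
noncomputable section

/-- For all reals `a > b > 0`, `1/2 < λ*(a,b) < 1`. -/
theorem lambdaStar_mem (a b : ℝ) (hb : 0 < b) (hab : b < a) :
    1 / 2 < lambdaStar a b ∧ lambdaStar a b < 1 := by
  have hx : 1 < a / b := (one_lt_div hb).2 hab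
  have ht : 0 < Real.log (a / b) := Real.log_pos hx
  have he : Real.exp (Real.log (a / b)) = a / b := Real.exp_log (by linarith)
  unfold lambdaStar
  generalize Real.log (a / b) = t at *
  rw [← he]
  have h1 : Real.exp (t / 2) * Real.exp (t / 2) = Real.exp t := by
    rw [← Real.exp_add]; ring_nf
  have h2 : Real.exp (t / 2) * Real.exp (-(t / 2)) = 1 := by
    rw [← Real.exp_add]; simp
  have h3 : Real.exp t * Real.exp (-t) = 1 := by
    rw [← Real.exp_add]; simp
  have hs : t / 2 < Real.sinh (t / 2) := Real.self_lt_sinh_iff.2 (by linarith)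
  rw [Real.sinh_eq] at hs
  have hu : -t + 1 < Real.exp (-t) := Real.add_one_lt_exp (by linarith)
  have hp : 0 < (Real.exp t - 1) / t := by
    apply div_pos _ ht
    rw [he]; linarith
  constructor
  · rw [lt_div_iff₀ ht, Real.lt_log_iff_exp_lt hp, lt_div_iff₀ ht,
      show 1 / 2 * t = t / 2 by ring]
    nlinarith [Real.exp_pos (t / 2)]
  · rw [div_lt_one ht, Real.log_lt_iff_lt_exp hp, div_lt_iff₀ ht]
    nlinarith [Real.exp_pos t]
end
end

section
/- Let c > 0 and let R_0, R_1, ..., R_t be positive reals with R_t ≤ c. Then the product over all indices i ∈ {1, ..., t} with R_{i-1} > c of the ratios R_i/R_{i-1} is at most 1. -/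
theorem prod_ratios_aux (c : ℝ) (hc : 0 < c) (R : ℕ → ℝ) (t : ℕ)
    (hpos : ∀ i ≤ t, 0 < R i) :
    (∏ i ∈ (Finset.Icc 1 t).filter (fun i => c < R (i - 1)), R i / R (i - 1)) * c
      ≤ max (R t) c := by
  induction t with
  | zero => simp
  | succ n ih =>
    have ih' := ih (fun i hi => hpos i (by omega))
    have h0 := hpos n (by omega)
    have h1 := hpos (n + 1) le_rfl
    rw [Finset.prod_filter] at ih' ⊢
    rw [Finset.prod_Icc_succ_top (by omega)]
    simp only [Nat.add_sub_cancel]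
    split_ifs with h
    · rw [max_eq_left h.le] at ih'
      refine le_trans ?_ (le_max_left _ _)
      have h2 := mul_le_mul_of_nonneg_right ih' (div_pos h1 h0).le
      rw [mul_div_cancel₀ _ h0.ne'] at h2
      linarith
    · rw [max_eq_right (not_lt.mp h)] at ih'
      rw [mul_one]
      exact le_trans ih' (le_max_right _ _)

/-- Let `c > 0` and let `R_0, R_1, …, R_t` be positive reals with
`R_t ≤ c`. Then the product, over all indices `i ∈ {1,…,t}` with `R_{i-1} > c`, of the
ratios `R_i / R_{i-1}` is at most `1` (the empty product being `1`). -/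
theorem prod_ratios_le_one (c : ℝ) (hc : 0 < c) (t : ℕ) (R : ℕ → ℝ)
    (hpos : ∀ i ≤ t, 0 < R i) (hlast : R t ≤ c) :
    ∏ i ∈ (Finset.Icc 1 t).filter (fun i => c < R (i - 1)), R i / R (i - 1) ≤ 1 := by
  have h := prod_ratios_aux c hc R t hpos
  rw [max_eq_right hlast] at h
  exact le_of_mul_le_mul_right (by linarith) hc
end

section
/- For all reals a > b > 0 and all p ∈ [0,1], the inequality (1 − (a/(a+b))·p)/(1 − (b/(a+b))·p) ≤ exp(−((a−b)/(a+b))·p) holds. -/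
/-- For all reals `a > b > 0` and all `p ∈ [0,1]`,
`(1 − (a/(a+b))p)/(1 − (b/(a+b))p) ≤ exp(−((a−b)/(a+b))·p)`. -/
theorem ratio_le_exp (a b p : ℝ) (hb : 0 < b) (hab : b < a)
    (hp : p ∈ Set.Icc (0 : ℝ) 1) :
    (1 - a / (a + b) * p) / (1 - b / (a + b) * p)
      ≤ Real.exp (-((a - b) / (a + b)) * p) := by
  obtain ⟨hp0, hp1⟩ := hp
  have hs : 0 < a + b := by linarith
  have h1 : a / (a + b) = 1 - b / (a + b) := by field_simp; ring
  have h2 : (a - b) / (a + b) = 1 - 2 * (b / (a + b)) := by field_simp; ring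
  have hx0 : 0 < b / (a + b) := by positivity
  have hx1 : 0 < (a - b) / (a + b) := div_pos (by linarith) hs
  rw [h2] at hx1
  rw [h1, h2]
  generalize b / (a + b) = x at *
  have hd : 0 < 1 - x * p := by nlinarith
  have he := Real.add_one_le_exp (-(1 - 2 * x) * p)
  refine le_trans ?_ he
  rw [div_le_iff₀ hd]
  nlinarith [mul_nonneg (mul_pos hx0 hx1).le (sq_nonneg p)]
end

section
/- Fix reals a > b > 0 and for p ∈ (0,1) define q(p) := log((1 − (b/(a+b))p)/(1 − (a/(a+b))p)) / log((a/b)·(1 − (b/(a+b))p)/(1 − (a/(a+b))p)). Then there exist a constant C = C(a,b) < ∞ and p_0 > 0 such that for all p ∈ (0, p_0]: (i) ((a/(a+b))·p)/q(p) ≥ exp((1 − λ*)·log(a/b) − f_{λ*}·p − C·p²), and (ii) (1 − (a/(a+b))·p)/(1 − q(p)) ≥ exp((1 − λ*)·log((1 − (a/(a+b))p)/(1 − (b/(a+b))p)) − f_{λ*}·p − C·p²). -/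
noncomputable section

/-- `q(p)` is chosen so that a random variable taking the value `log(a/b)` with
probability `q(p)` and the value `log((1 − (a/(a+b))p)/(1 − (b/(a+b))p))` with
probability `1 − q(p)` has mean zero. -/
def qVal (a b p : ℝ) : ℝ :=
  Real.log ((1 - b / (a + b) * p) / (1 - a / (a + b) * p)) /
    Real.log (a / b * ((1 - b / (a + b) * p) / (1 - a / (a + b) * p)))

lemma aux_loglog (x : ℝ) (hx : 1 < x) :
    Real.log (Real.log x) ≤ Real.log (x - 1) - Real.log x / 2 := by
  have hL : 0 < Real.log x := Real.log_pos hx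
  have h1 : Real.log x / 2 ≤ Real.sinh (Real.log x / 2) :=
    Real.self_le_sinh_iff.2 (by linarith)
  have h2 : Real.log x * Real.exp (Real.log x / 2) ≤ x - 1 := by
    have e1 : Real.exp (Real.log x / 2) * Real.exp (Real.log x / 2) = x := by
      rw [← Real.exp_add, add_halves, Real.exp_log (by linarith)]
    have e2 : Real.exp (-(Real.log x / 2)) * Real.exp (Real.log x / 2) = 1 := by
      rw [← Real.exp_add]; simp
    rw [Real.sinh_eq] at h1
    have := mul_le_mul_of_nonneg_right h1 (Real.exp_pos (Real.log x / 2)).le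
    nlinarith
  have h3 := Real.log_le_log (by positivity) h2
  rw [Real.log_mul hL.ne' (Real.exp_pos _).ne', Real.log_exp] at h3
  linarith

lemma aux_log_one_sub (x : ℝ) (h0 : 0 ≤ x) (h1 : x ≤ 1 / 2) :
    -x - 2 * x ^ 2 ≤ Real.log (1 - x) := by
  have h := Real.one_sub_inv_le_log_of_pos (show 0 < 1 - x by linarith)
  have : (1 - x)⁻¹ ≤ 1 + x + 2 * x ^ 2 := by
    rw [inv_le_iff_one_le_mul₀ (by linarith)]
    nlinarith [mul_nonneg (sq_nonneg x) (show 0 ≤ 1 - 2 * x by linarith)]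
  linarith

lemma aux_log_one_add (x : ℝ) (h0 : 0 ≤ x) : x - x ^ 2 ≤ Real.log (1 + x) := by
  have h := Real.one_sub_inv_le_log_of_pos (show 0 < 1 + x by linarith)
  have : (1 + x)⁻¹ ≤ 1 - x + x ^ 2 := by
    rw [inv_le_iff_one_le_mul₀ (by linarith)]
    nlinarith [pow_nonneg h0 3]
  linarith

/-- There exist a constant `C = C(a,b) < ∞` and `p₀ > 0` such that for
all `p ∈ (0, p₀]`:
(i) `((a/(a+b))p)/q(p) ≥ exp((1 − λ*)·log(a/b) − f_{λ*}·p − C·p²)`, and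
(ii) `(1 − (a/(a+b))p)/(1 − q(p))
      ≥ exp((1 − λ*)·log((1 − (a/(a+b))p)/(1 − (b/(a+b))p)) − f_{λ*}·p − C·p²)`. -/
theorem radon_nikodym_factor_bounds (a b : ℝ) (hb : 0 < b) (hab : b < a) :
    ∃ (C p₀ : ℝ), 0 < p₀ ∧ ∀ p ∈ Set.Ioc (0 : ℝ) p₀,
      Real.exp ((1 - lambdaStar a b) * Real.log (a / b)
            - fFun a b (lambdaStar a b) * p - C * p ^ 2)
        ≤ a / (a + b) * p / qVal a b p ∧
      Real.exp ((1 - lambdaStar a b) *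
              Real.log ((1 - a / (a + b) * p) / (1 - b / (a + b) * p))
            - fFun a b (lambdaStar a b) * p - C * p ^ 2)
        ≤ (1 - a / (a + b) * p) / (1 - qVal a b p) := by
  have ha : 0 < a := hb.trans hab
  have ht : 1 < a / b := (one_lt_div hb).2 hab
  have hs : 0 < a + b := by linarith
  have hL : 0 < Real.log (a / b) := Real.log_pos ht
  have hlam : lambdaStar a b * Real.log (a / b)
      = Real.log (a / b - 1) - Real.log (Real.log (a / b)) := by
    unfold lambdaStar
    rw [div_mul_cancel₀ _ hL.ne', Real.log_div (by linarith) hL.ne']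
  have hlow : 1 / 2 ≤ lambdaStar a b := by
    have := aux_loglog _ ht
    by_contra hc
    push Not at hc
    nlinarith
  have hup : lambdaStar a b ≤ 1 := by
    have h1 : a / b - 1 ≤ a / b * Real.log (a / b) := by
      have h := Real.one_sub_inv_le_log_of_pos (show 0 < a / b by linarith)
      have := mul_le_mul_of_nonneg_left h (show 0 ≤ a / b by linarith)
      rwa [mul_sub, mul_inv_cancel₀ (by linarith), mul_one] at this
    have h2 := Real.log_le_log (by linarith) h1
    rw [Real.log_mul (by linarith) hL.ne'] at h2
    by_contra hc
    push Not at hc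
    nlinarith
  have hpow : a ^ lambdaStar a b * b ^ (1 - lambdaStar a b) = (a - b) / Real.log (a / b) := by
    have h1 : (a / b) ^ lambdaStar a b = (a / b - 1) / Real.log (a / b) := by
      rw [Real.rpow_def_of_pos (by linarith), mul_comm, hlam,
        ← Real.log_div (by linarith) hL.ne', Real.exp_log (div_pos (by linarith) hL)]
    rw [Real.rpow_sub hb, Real.rpow_one]
    rw [Real.div_rpow ha.le hb.le] at h1
    calc _ = b * (a ^ lambdaStar a b / b ^ lambdaStar a b) := by ring
      _ = _ := by rw [h1]; field_simp
  have hf : fFun a b (lambdaStar a b) = lambdaStar a b * (a / (a + b))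
      + (1 - lambdaStar a b) * (b / (a + b))
      - (a / (a + b) - b / (a + b)) / Real.log (a / b) := by
    unfold fFun
    rw [hpow]
    field_simp
  have hα : 0 < a / (a + b) := by positivity
  have hβ : 0 < b / (a + b) := by positivity
  have hαβ : a / (a + b) + b / (a + b) = 1 := by field_simp
  have hδ : b / (a + b) < a / (a + b) := by gcongr
  have htαβ : Real.log (a / b - 1) = Real.log (a / (a + b) - b / (a + b))
      - Real.log (a / (a + b)) + Real.log (a / b) := by
    rw [← Real.log_div (by linarith) hα.ne', ← Real.log_mul _ (by linarith)]
    · congr 1; field_simp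
    · exact (div_pos (by linarith) hα).ne'
  unfold qVal
  rw [hf]
  generalize lambdaStar a b = l at *
  generalize a / (a + b) = α at *
  generalize b / (a + b) = β at *
  have ht0 : a / b ≠ 0 := by linarith
  generalize a / b = t at *
  generalize hLdef : Real.log t = L at *
  refine ⟨4 * ((α - β) / L) ^ 2 + 2, 1 / 2, by norm_num, ?_⟩
  rintro p ⟨hp0, hp1⟩
  have hA : α * p ≤ 1 / 2 := by nlinarith
  have hA0 : 0 < α * p := by positivity
  have hB : β * p ≤ 1 / 2 := by nlinarith
  have hB0 : 0 < β * p := by positivity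
  have hD0 : 0 < (α - β) * p := mul_pos (by linarith) hp0
  have hx0 : 0 < (1 - β * p) / (1 - α * p) := div_pos (by linarith) (by linarith)
  have hx1 : (1 - β * p) / (1 - α * p) - 1 = (α - β) * p / (1 - α * p) := by
    have : 1 - α * p ≠ 0 := by linarith
    rw [eq_div_iff this, sub_mul, div_mul_cancel₀ _ this]; ring
  have hx2 : 1 < (1 - β * p) / (1 - α * p) := by
    have : 0 < (α - β) * p / (1 - α * p) := div_pos hD0 (by linarith)
    linarith
  have hlogx : Real.log ((1 - β * p) / (1 - α * p))
      = Real.log (1 - β * p) - Real.log (1 - α * p) :=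
    Real.log_div (by linarith) (by linarith)
  have hu0 := Real.log_pos hx2
  have huu : Real.log ((1 - β * p) / (1 - α * p)) ≤ 2 * ((α - β) * p) := by
    refine (Real.log_le_sub_one_of_pos hx0).trans ?_
    rw [hx1, div_le_iff₀ (by linarith)]
    nlinarith
  have hul : (α - β) * p ≤ Real.log ((1 - β * p) / (1 - α * p)) := by
    refine le_trans ?_ (Real.one_sub_inv_le_log_of_pos hx0)
    rw [inv_div, le_sub_comm, div_le_iff₀ (by linarith)]
    nlinarith
  have hull := aux_loglog _ hx2
  rw [hx1, Real.log_div hD0.ne' (by linarith), Real.log_mul (by linarith) hp0.ne'] at hull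
  have hla := aux_log_one_sub _ hA0.le hA
  have hlb := aux_log_one_sub _ hB0.le hB
  have hinv : Real.log ((1 - α * p) / (1 - β * p))
      = -Real.log ((1 - β * p) / (1 - α * p)) := by
    rw [← Real.log_inv, inv_div]
  rw [hinv, Real.log_mul ht0 hx0.ne', hLdef]
  generalize Real.log ((1 - β * p) / (1 - α * p)) = u at *
  have huL : 0 < u / L := div_pos hu0 hL
  have hadd := aux_log_one_add _ huL.le
  have hsq : (u / L) ^ 2 ≤ 4 * ((α - β) / L) ^ 2 * p ^ 2 := by
    have : u / L ≤ 2 * ((α - β) * p) / L := by gcongr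
    calc (u / L) ^ 2 ≤ (2 * ((α - β) * p) / L) ^ 2 := by gcongr
      _ = _ := by ring
  have hlin : (α - β) / L * p ≤ u / L := by
    rw [div_mul_eq_mul_div]; gcongr
  have hsum : Real.log (L + u) = Real.log L + Real.log (1 + u / L) := by
    rw [← Real.log_mul hL.ne' (by positivity)]
    congr 1; field_simp
  have hLu : 0 < L + u := by linarith
  have hβe : β = 1 - α := by linarith
  have hl0 : 0 ≤ (l - 1 / 2) * ((α - β) * p) := mul_nonneg (by linarith) hD0.le
  have hl1 : 0 ≤ (1 - l) * (u - (α - β) * p) := mul_nonneg (by linarith) (by linarith)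
  have hαβ0 : 0 ≤ α * β * p ^ 2 := by positivity
  have hα2 : α ^ 2 * p ^ 2 ≤ p ^ 2 := by
    have : α ^ 2 ≤ 1 := pow_le_one₀ hα.le (by linarith)
    exact mul_le_of_le_one_left (sq_nonneg p) this
  have hαβ2 : α ^ 2 * p ^ 2 + β ^ 2 * p ^ 2 + 2 * (α * β * p ^ 2) = p ^ 2 := by
    rw [hβe]; ring
  have hαp : α * p + β * p = p := by rw [← add_mul, hαβ, one_mul]
  have hp2 := sq_nonneg p
  constructor
  · rw [← Real.le_log_iff_exp_le (by positivity), div_div_eq_mul_div,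
      Real.log_div (by positivity) hu0.ne', Real.log_mul hA0.ne' hLu.ne',
      Real.log_mul hα.ne' hp0.ne', hsum]
    linarith
  · have h1q : 1 - u / (L + u) = L / (L + u) := by field_simp; ring
    have h1A : 0 < 1 - α * p := by linarith
    rw [h1q, ← Real.le_log_iff_exp_le (by positivity), div_div_eq_mul_div,
      Real.log_div (by positivity) hL.ne', Real.log_mul h1A.ne' hLu.ne', hsum]
    linarith
end
end

section
/- Set δ := 1/(2·log(1 + a/b)). If the revealing probabilities satisfy M_t := ∑_{i=1}^t p_i ≤ δ·log t, then for all sufficiently large t, P(MAP(Z_1, ..., Z_{t-1}, X_t) ≠ θ) ≥ (b²/(2(a+b)²))·t^{−0.9}; in particular P(MAP(Z_1, ..., Z_{t-1}, X_t) ≠ θ) = ω(1/t) along such times t. -/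
open MeasureTheory ProbabilityTheory Filter Asymptotics
open scoped ENNReal NNReal

noncomputable section

open Classical in
lemma cas_measure {a b : ℝ} {p : ℕ → ℝ} {Ω : Type*} [MeasurableSpace Ω] {μ : Measure Ω}
    {θ : Ω → ℕ} {X I Z : ℕ → Ω → ℕ} (hC : IsCascade a b p μ θ X I Z)
    (i : ℕ) (hi : i = 1 ∨ i = 2) (S : ℕ → ℕ → ℕ → Prop) (s : Finset ℕ) :
    ∀ (u : Finset ℕ), Disjoint s u → (∀ t ∈ s, 1 ≤ t) → (∀ t ∈ u, 1 ≤ t) →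
    ∀ x c : ℕ → ℕ, (∀ t, x t = 1 ∨ x t = 2) → (∀ t, c t = 0 ∨ c t = 1) →
    (μ {ω | θ ω = i ∧ (∀ t ∈ s, S t (X t ω) (I t ω)) ∧
        ∀ t ∈ u, X t ω = x t ∧ I t ω = c t}).toReal
      = 1 / 2 * (∏ t ∈ s, ((if S t 1 0 then signalProb a b i 1 * (1 - p t) else 0)
          + (if S t 1 1 then signalProb a b i 1 * p t else 0)
          + (if S t 2 0 then signalProb a b i 2 * (1 - p t) else 0)
          + (if S t 2 1 then signalProb a b i 2 * p t else 0)))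
        * ∏ t ∈ u, signalProb a b i (x t) * (if c t = 1 then p t else 1 - p t) := by
  have := hC.prob
  induction s using Finset.induction_on with
  | empty =>
    intro u _ _ hu x c hx hc
    simpa using hC.joint i hi u hu x c hx hc
  | insert n s hn ih =>
    intro u hd hs hu x c hx hc
    rw [Finset.disjoint_insert_left] at hd
    obtain ⟨hnu, hd⟩ := hd
    have hn1 : 1 ≤ n := hs n (Finset.mem_insert_self _ _)
    have hs' : ∀ t ∈ s, 1 ≤ t := fun t ht => hs t (Finset.mem_insert_of_mem ht)
    have hu' : ∀ t ∈ insert n u, 1 ≤ t := by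
      intro t ht
      rcases Finset.mem_insert.1 ht with rfl | h
      · exact hn1
      · exact hu t h
    have hd' : Disjoint s (insert n u) := by
      rw [Finset.disjoint_insert_right]; exact ⟨hn, hd⟩
    let E : ℕ → ℕ → Set Ω := fun y d => {ω | θ ω = i ∧ (∀ t ∈ s, S t (X t ω) (I t ω)) ∧
        ∀ t ∈ insert n u, X t ω = Function.update x n y t ∧ I t ω = Function.update c n d t}
    have hEm : ∀ y d ω, ω ∈ E y d ↔ (θ ω = i ∧ (∀ t ∈ s, S t (X t ω) (I t ω)) ∧
        (∀ t ∈ u, X t ω = x t ∧ I t ω = c t) ∧ X n ω = y ∧ I n ω = d) := by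
      intro y d ω
      have h1 : (∀ t ∈ u, X t ω = Function.update x n y t ∧ I t ω = Function.update c n d t)
          ↔ (∀ t ∈ u, X t ω = x t ∧ I t ω = c t) := by
        refine forall₂_congr fun t ht => ?_
        have : t ≠ n := fun h => hnu (h ▸ ht)
        simp [Function.update_of_ne this]
      simp only [E, Set.mem_ofPred_eq, Finset.forall_mem_insert, Function.update_self, h1]
      tauto
    have hE : ∀ y d, (y = 1 ∨ y = 2) → (d = 0 ∨ d = 1) → (μ (E y d)).toReal =
        1 / 2 * (∏ t ∈ s, ((if S t 1 0 then signalProb a b i 1 * (1 - p t) else 0)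
          + (if S t 1 1 then signalProb a b i 1 * p t else 0)
          + (if S t 2 0 then signalProb a b i 2 * (1 - p t) else 0)
          + (if S t 2 1 then signalProb a b i 2 * p t else 0)))
        * ((signalProb a b i y * (if d = 1 then p n else 1 - p n)) *
           ∏ t ∈ u, signalProb a b i (x t) * (if c t = 1 then p t else 1 - p t)) := by
      intro y d hy hd2
      have := ih (insert n u) hd' hs' hu' (Function.update x n y) (Function.update c n d)
        (by intro t; by_cases h : t = n
            · subst h; simpa using hy
            · simpa [Function.update_of_ne h] using hx t)
        (by intro t; by_cases h : t = n
            · subst h; simpa using hd2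
            · simpa [Function.update_of_ne h] using hc t)
      rw [this, Finset.prod_insert hnu]
      simp only [Function.update_self]
      congr 2
      refine Finset.prod_congr rfl fun t ht => ?_
      have : t ≠ n := fun h => hnu (h ▸ ht)
      simp [Function.update_of_ne this]
    have hmeas : ∀ y d, MeasurableSet (E y d) := by
      intro y d
      have hEeq : E y d = {ω | θ ω = i} ∩ ((⋂ t ∈ s, {ω | S t (X t ω) (I t ω)}) ∩
          ⋂ t ∈ insert n u, {ω | X t ω = Function.update x n y t ∧
            I t ω = Function.update c n d t}) := by
        ext ω; simp [E]
      rw [hEeq]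
      refine (hC.theta_meas (measurableSet_singleton i)).inter (MeasurableSet.inter ?_ ?_)
      · refine Finset.measurableSet_biInter _ fun t _ => ?_
        exact ((hC.X_meas t).prodMk (hC.I_meas t))
          (MeasurableSet.of_discrete (s := {q : ℕ × ℕ | S t q.1 q.2}))
      · refine Finset.measurableSet_biInter _ fun t _ => ?_
        exact ((hC.X_meas t) (measurableSet_singleton _)).inter
          ((hC.I_meas t) (measurableSet_singleton _))
    let G : ℕ → ℕ → Set Ω := fun y d => if S n y d then E y d else ∅
    have hGm : ∀ y d, MeasurableSet (G y d) := by
      intro y d; simp only [G]; split_ifs; exacts [hmeas y d, MeasurableSet.empty]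
    have hGmem : ∀ y d ω, ω ∈ G y d ↔ S n y d ∧ ω ∈ E y d := by
      intro y d ω; simp only [G]; split_ifs with h <;> simp [h]
    have hGv : ∀ y d, (y = 1 ∨ y = 2) → (d = 0 ∨ d = 1) → (μ (G y d)).toReal =
        if S n y d then (μ (E y d)).toReal else 0 := by
      intro y d _ _; simp only [G]; split_ifs <;> simp
    have hset : {ω | θ ω = i ∧ (∀ t ∈ insert n s, S t (X t ω) (I t ω)) ∧
        ∀ t ∈ u, X t ω = x t ∧ I t ω = c t} = ((G 1 0 ∪ G 1 1) ∪ G 2 0) ∪ G 2 1 := by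
      ext ω
      simp only [Set.mem_union, hGmem, hEm, Set.mem_ofPred_eq, Finset.forall_mem_insert]
      rcases hC.X_range n ω with h | h <;> rcases hC.I_range n ω with h' | h' <;>
        simp [h, h'] <;> tauto
    have hdisj : ∀ y d y' d', (y ≠ y' ∨ d ≠ d') → Disjoint (G y d) (G y' d') := by
      intro y d y' d' h
      rw [Set.disjoint_left]
      intro ω h1 h2
      rw [hGmem, hEm] at h1 h2
      obtain ⟨_, _, _, _, e1, e2⟩ := h1
      obtain ⟨_, _, _, _, e3, e4⟩ := h2
      rcases h with h | h
      · exact h (e1.symm.trans e3)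
      · exact h (e2.symm.trans e4)
    rw [hset, measure_union _ (hGm 2 1), measure_union _ (hGm 2 0), measure_union _ (hGm 1 1),
      ENNReal.toReal_add (by finiteness) (by finiteness),
      ENNReal.toReal_add (by finiteness) (by finiteness),
      ENNReal.toReal_add (by finiteness) (by finiteness),
      hGv 1 0 (by simp) (by simp), hGv 1 1 (by simp) (by simp), hGv 2 0 (by simp) (by simp),
      hGv 2 1 (by simp) (by simp), hE 1 0 (by simp) (by simp), hE 1 1 (by simp) (by simp),
      hE 2 0 (by simp) (by simp), hE 2 1 (by simp) (by simp), Finset.prod_insert hn]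
    · simp only [if_true, zero_ne_one, if_false]
      split_ifs <;> ring
    · exact hdisj _ _ _ _ (by simp)
    · rw [Set.disjoint_union_left]
      exact ⟨hdisj _ _ _ _ (by simp), hdisj _ _ _ _ (by simp)⟩
    · rw [Set.disjoint_union_left, Set.disjoint_union_left]
      exact ⟨⟨hdisj _ _ _ _ (by simp), hdisj _ _ _ _ (by simp)⟩, hdisj _ _ _ _ (by simp)⟩

/-- the all-ones condition on signal and indicator at time `s` -/
def casS (s x c : ℕ) : Prop := if s ≤ 2 then x = 1 else ¬ (c = 1 ∧ x = 2)

def casW (a b : ℝ) (p : ℕ → ℝ) (i s : ℕ) : ℝ :=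
  if s ≤ 2 then signalProb a b i 1 else 1 - p s * signalProb a b i 2

lemma sig_sum {a b : ℝ} (hb : 0 < b) (hab : b < a) (i : ℕ) (hi : i = 1 ∨ i = 2) :
    signalProb a b i 1 + signalProb a b i 2 = 1 := by
  have : a + b ≠ 0 := by linarith
  rcases hi with rfl | rfl <;> simp [signalProb] <;> field_simp
  ring

lemma cas_measure1 {a b : ℝ} (hb : 0 < b) (hab : b < a) {p : ℕ → ℝ} {Ω : Type*}
    [MeasurableSpace Ω] {μ : Measure Ω}
    {θ : Ω → ℕ} {X I Z : ℕ → Ω → ℕ} (hC : IsCascade a b p μ θ X I Z)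
    (i : ℕ) (hi : i = 1 ∨ i = 2) (n : ℕ) :
    (μ {ω | θ ω = i ∧ (∀ s ∈ Finset.Icc 1 n, casS s (X s ω) (I s ω))}).toReal
      = 1 / 2 * ∏ s ∈ Finset.Icc 1 n, casW a b p i s := by
  have h := cas_measure hC i hi casS (Finset.Icc 1 n) ∅ (by simp)
    (by intro t ht; exact (Finset.mem_Icc.1 ht).1) (by simp) (fun _ => 1) (fun _ => 0)
    (by simp) (by simp)
  simp only [Finset.notMem_empty, false_imp_iff, implies_true, and_true, Finset.prod_empty,
    mul_one] at h
  rw [h]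
  congr 1
  refine Finset.prod_congr rfl fun t _ => ?_
  have := sig_sum hb hab i hi
  by_cases h2 : t ≤ 2
  · simp [casS, casW, h2]; ring
  · simp [casS, casW, h2]; linear_combination this

lemma cas_measure2 {a b : ℝ} (hb : 0 < b) (hab : b < a) {p : ℕ → ℝ} {Ω : Type*}
    [MeasurableSpace Ω] {μ : Measure Ω}
    {θ : Ω → ℕ} {X I Z : ℕ → Ω → ℕ} (hC : IsCascade a b p μ θ X I Z)
    (i : ℕ) (hi : i = 1 ∨ i = 2) (n : ℕ) (x : ℕ) (hx : x = 1 ∨ x = 2) :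
    (μ {ω | θ ω = i ∧ (∀ s ∈ Finset.Icc 1 n, casS s (X s ω) (I s ω)) ∧ X (n+1) ω = x}).toReal
      = 1 / 2 * ((∏ s ∈ Finset.Icc 1 n, casW a b p i s) * signalProb a b i x) := by
  have h := cas_measure hC i hi (fun s y c => if s = n + 1 then y = x else casS s y c)
    (Finset.Icc 1 (n+1)) ∅ (by simp)
    (by intro t ht; exact (Finset.mem_Icc.1 ht).1) (by simp) (fun _ => 1) (fun _ => 0)
    (by simp) (by simp)
  simp only [Finset.notMem_empty, false_imp_iff, implies_true, and_true, Finset.prod_empty,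
    mul_one] at h
  have hset : {ω | θ ω = i ∧ (∀ s ∈ Finset.Icc 1 n, casS s (X s ω) (I s ω)) ∧ X (n+1) ω = x}
      = {ω | θ ω = i ∧ ∀ t ∈ Finset.Icc 1 (n+1),
        if t = n + 1 then X t ω = x else casS t (X t ω) (I t ω)} := by
    ext ω
    simp only [Set.mem_ofPred_eq]
    refine and_congr_right fun _ => ⟨fun h t ht => ?_, fun h => ⟨fun t ht => ?_, ?_⟩⟩
    · split_ifs with h1
      · rw [h1]; exact h.2
      · exact h.1 t (by rw [Finset.mem_Icc] at *; omega)
    · have := h t (by rw [Finset.mem_Icc] at *; omega)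
      rwa [if_neg (by rw [Finset.mem_Icc] at ht; omega)] at this
    · have := h (n+1) (by simp)
      simpa using this
  rw [hset, h]
  congr 1
  rw [Finset.prod_Icc_succ_top (by omega)]
  congr 1
  · refine Finset.prod_congr rfl fun t ht => ?_
    have hne : t ≠ n + 1 := by rw [Finset.mem_Icc] at ht; omega
    have := sig_sum hb hab i hi
    by_cases h2 : t ≤ 2
    · simp [casS, casW, h2, hne]; ring
    · simp [casS, casW, h2, hne]; linear_combination this
  · rcases hx with rfl | rfl <;> simp <;> ring

/-- likelihoods along the all-ones history -/
lemma cas_key {a b : ℝ} (hb : 0 < b) (hab : b < a) {p : ℕ → ℝ}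
    (hp : ∀ t : ℕ, 1 ≤ t → p t ∈ Set.Icc (0 : ℝ) 1) (n : ℕ) (hn : 2 ≤ n) :
    0 < (∏ s ∈ Finset.Icc 1 n, casW a b p 1 s) ∧
    b ^ 2 * (∏ s ∈ Finset.Icc 1 n, casW a b p 1 s) ≥
      a ^ 2 * ∏ s ∈ Finset.Icc 1 n, casW a b p 2 s := by
  have hs : 0 < a + b := by linarith
  induction n, hn using Nat.le_induction with
  | base =>
    rw [show Finset.Icc 1 2 = {1, 2} from rfl]
    have ha : 0 < a := by linarith
    have e1 : ∏ s ∈ ({1, 2} : Finset ℕ), casW a b p 1 s = (a / (a + b)) * (a / (a + b)) := by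
      rw [Finset.prod_pair (by norm_num)]; simp [casW, signalProb]
    have e2 : ∏ s ∈ ({1, 2} : Finset ℕ), casW a b p 2 s = (b / (a + b)) * (b / (a + b)) := by
      rw [Finset.prod_pair (by norm_num)]; simp [casW, signalProb]
    rw [e1, e2]
    constructor
    · positivity
    · apply le_of_eq; ring
  | succ n hn ih =>
    obtain ⟨h1, h2⟩ := ih
    obtain ⟨hp0, hp1⟩ := hp (n+1) (by omega)
    rw [Finset.prod_Icc_succ_top (by omega), Finset.prod_Icc_succ_top (by omega)]
    have e1 : casW a b p 1 (n+1) = 1 - p (n+1) * (b / (a+b)) := by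
      simp [casW, signalProb, show ¬ (n + 1 ≤ 2) by omega]
    have e2 : casW a b p 2 (n+1) = 1 - p (n+1) * (a / (a+b)) := by
      simp [casW, signalProb, show ¬ (n + 1 ≤ 2) by omega]
    have hb1 : b / (a+b) < 1 := by rw [div_lt_one hs]; linarith
    have ha1 : a / (a+b) < 1 := by rw [div_lt_one hs]; linarith
    have hba : b / (a+b) ≤ a / (a+b) := by gcongr
    have hb0 : 0 < b / (a+b) := by positivity
    have f1 : 0 < casW a b p 1 (n+1) := by rw [e1]; nlinarith
    have f2 : 0 < casW a b p 2 (n+1) := by rw [e2]; nlinarith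
    have f3 : casW a b p 2 (n+1) ≤ casW a b p 1 (n+1) := by rw [e1, e2]; nlinarith
    refine ⟨mul_pos h1 f1, ?_⟩
    rw [← mul_assoc, ← mul_assoc]
    calc _ ≤ b ^ 2 * (∏ s ∈ Finset.Icc 1 n, casW a b p 1 s) * casW a b p 2 (n+1) := by gcongr
      _ ≤ _ := by gcongr

lemma cas_Dlike {a b : ℝ} (hb : 0 < b) (hab : b < a) {p : ℕ → ℝ} {Ω : Type*}
    [MeasurableSpace Ω] {μ : Measure Ω}
    {θ : Ω → ℕ} {X I Z : ℕ → Ω → ℕ} (hC : IsCascade a b p μ θ X I Z) (n : ℕ)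
    (H : ∀ ω, (∀ s ∈ Finset.Icc 1 n, Z s ω = 1) ↔
      ∀ s ∈ Finset.Icc 1 n, casS s (X s ω) (I s ω))
    (ω : Ω) (hω : ∀ s ∈ Finset.Icc 1 n, Z s ω = 1) (i : ℕ) (hi : i = 1 ∨ i = 2) :
    Dlike μ θ X Z (n + 1) i ω =
      (∏ s ∈ Finset.Icc 1 n, casW a b p i s) * signalProb a b i (X (n + 1) ω) := by
  have h1 := cas_measure2 hb hab hC i hi n (X (n+1) ω) (hC.X_range _ _)
  have h0 := cas_measure1 hb hab hC i hi 0
  have e0 : {ω | θ ω = i ∧ ∀ s ∈ Finset.Icc 1 0, casS s (X s ω) (I s ω)} = {ω | θ ω = i} := by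
    ext ω; simp
  have e1 : {ω' | θ ω' = i ∧ (∀ s ∈ Finset.Icc 1 (n + 1 - 1), Z s ω' = Z s ω) ∧
      X (n + 1) ω' = X (n + 1) ω} = {ω' | θ ω' = i ∧
        (∀ s ∈ Finset.Icc 1 n, casS s (X s ω') (I s ω')) ∧ X (n+1) ω' = X (n + 1) ω} := by
    ext ω'
    simp only [Set.mem_ofPred_eq, ← H, Nat.add_sub_cancel]
    have : (∀ s ∈ Finset.Icc 1 n, Z s ω' = Z s ω) ↔ (∀ s ∈ Finset.Icc 1 n, Z s ω' = 1) :=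
      forall₂_congr fun s hs => by rw [hω s hs]
    rw [this]
  rw [e0] at h0
  unfold Dlike
  rw [e1, h1, h0]
  simp
  ring

lemma cas_map {a b : ℝ} (hb : 0 < b) (hab : b < a) {p : ℕ → ℝ} {Ω : Type*}
    [MeasurableSpace Ω] {μ : Measure Ω}
    {θ : Ω → ℕ} {X I Z : ℕ → Ω → ℕ} (hC : IsCascade a b p μ θ X I Z) (n : ℕ)
    (H : ∀ ω, (∀ s ∈ Finset.Icc 1 n, Z s ω = 1) ↔
      ∀ s ∈ Finset.Icc 1 n, casS s (X s ω) (I s ω))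
    (ω : Ω) (hω : ∀ s ∈ Finset.Icc 1 n, Z s ω = 1) :
    mapEst μ θ X Z (n + 1) ω = if n + 1 ≤ 2 then X (n + 1) ω else 1 := by
  have h1 := cas_Dlike hb hab hC n H ω hω 1 (by simp)
  have h2 := cas_Dlike hb hab hC n H ω hω 2 (by simp)
  have ha : 0 < a := by linarith
  have hlt : b / (a + b) < a / (a + b) := by gcongr
  have hb0 : 0 < b / (a + b) := by positivity
  unfold mapEst
  rw [h1, h2]
  by_cases hn : n + 1 ≤ 2
  · rw [if_pos hn]
    obtain rfl | rfl : n = 0 ∨ n = 1 := by omega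
    · rcases hC.X_range (0 + 1) ω with h | h <;> rw [h]
      · simp [signalProb, hlt]
      · simp [signalProb, hlt, hlt.le]
    · rcases hC.X_range (1 + 1) ω with h | h <;> rw [h]
      · have : b / (a + b) * (b / (a + b)) < a / (a + b) * (a / (a + b)) := by gcongr
        simp [signalProb, casW, this]
      · simp [signalProb, casW, mul_comm]
  · rw [if_neg hn, if_pos]
    obtain ⟨k1, k2⟩ := cas_key hb hab hC.p_mem n (by omega)
    set P := ∏ s ∈ Finset.Icc 1 n, casW a b p 1 s
    set Q := ∏ s ∈ Finset.Icc 1 n, casW a b p 2 s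
    have hs : 0 < a + b := by positivity
    have hkey : Q * a < P * b := by
      have : a * (Q * a) < a * (P * b) := by
        have : b * (P * b) < a * (P * b) := by gcongr
        nlinarith
      exact lt_of_mul_lt_mul_left this ha.le
    rcases hC.X_range (n + 1) ω with h | h <;> rw [h]
    · simp only [signalProb]
      norm_num
      rw [← mul_div_assoc, ← mul_div_assoc]
      gcongr ?_ / _
      rcases le_or_gt Q 0 with hQ | hQ
      · nlinarith [mul_pos k1 ha]
      · nlinarith
    · simp only [signalProb]
      norm_num
      rw [← mul_div_assoc, ← mul_div_assoc]
      gcongr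

lemma cas_hist {a b : ℝ} (hb : 0 < b) (hab : b < a) {p : ℕ → ℝ} {Ω : Type*}
    [MeasurableSpace Ω] {μ : Measure Ω}
    {θ : Ω → ℕ} {X I Z : ℕ → Ω → ℕ} (hC : IsCascade a b p μ θ X I Z) (n : ℕ) :
    ∀ ω, (∀ s ∈ Finset.Icc 1 n, Z s ω = 1) ↔
      ∀ s ∈ Finset.Icc 1 n, casS s (X s ω) (I s ω) := by
  induction n with
  | zero => simp
  | succ n ih =>
    intro ω
    rw [← Finset.insert_Icc_right_eq_Icc_add_one (by omega), Finset.forall_mem_insert,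
      Finset.forall_mem_insert, ← ih ω]
    refine and_congr_left fun hω => ?_
    rw [hC.dynamics (n+1) (by omega), cas_map hb hab hC n ih ω hω]
    unfold casS
    rcases hC.X_range (n + 1) ω with h | h <;> rcases hC.I_range (n + 1) ω with h' | h' <;>
      simp [h, h']

lemma cas_lower {a b : ℝ} (hb : 0 < b) (hab : b < a) {p : ℕ → ℝ}
    (hp : ∀ t : ℕ, 1 ≤ t → p t ∈ Set.Icc (0 : ℝ) 1) (n : ℕ) (hn : 2 ≤ n) :
    (b / (a + b)) ^ 2 * (b / (a + b)) ^ (∑ s ∈ Finset.Icc 1 n, p s) ≤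
      ∏ s ∈ Finset.Icc 1 n, casW a b p 2 s := by
  have ha : 0 < a := by linarith
  have hs : 0 < a + b := by linarith
  have hq : 0 < b / (a + b) := by positivity
  have hq1 : b / (a + b) ≤ 1 := by rw [div_le_one hs]; linarith
  induction n, hn using Nat.le_induction with
  | base =>
    rw [show Finset.Icc 1 2 = {1, 2} from rfl]
    have e2 : ∏ s ∈ ({1, 2} : Finset ℕ), casW a b p 2 s = (b / (a + b)) ^ 2 := by
      rw [Finset.prod_pair (by norm_num)]; simp [casW, signalProb, sq]
    rw [e2, Finset.sum_pair (by norm_num)]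
    have := Real.rpow_le_one hq.le hq1 (add_nonneg (hp 1 (by simp)).1 (hp 2 (by simp)).1)
    exact mul_le_of_le_one_right (by positivity) this
  | succ n hn ih =>
    obtain ⟨hp0, hp1⟩ := hp (n+1) (by omega)
    rw [Finset.prod_Icc_succ_top (by omega), Finset.sum_Icc_succ_top (by omega),
      Real.rpow_add hq, ← mul_assoc]
    have e2 : casW a b p 2 (n+1) = 1 - p (n+1) * (a / (a+b)) := by
      simp [casW, signalProb, show ¬ (n + 1 ≤ 2) by omega]
    have hstep : (b / (a + b)) ^ p (n + 1) ≤ casW a b p 2 (n+1) := by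
      rw [e2]
      have := rpow_one_add_le_one_add_mul_self (s := -(a / (a+b)))
        (by have : a / (a+b) ≤ 1 := by rw [div_le_one hs]; linarith
            linarith) hp0 hp1
      have e : 1 + -(a / (a + b)) = b / (a + b) := by field_simp; ring
      rw [e] at this
      linarith
    exact mul_le_mul ih hstep (by positivity) (le_trans (by positivity) ih)

/-- Set `δ := 1/(2·log(1 + a/b))`. For all sufficiently large `t`, if
`M_t = ∑_{i=1}^t p_i ≤ δ·log t`, then
`P(MAP(Z_1,…,Z_{t-1},X_t) ≠ θ) ≥ (b²/(2(a+b)²))·t^{−0.9}`; in particular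
`P(MAP(Z_1,…,Z_{t-1},X_t) ≠ θ) = ω(1/t)` along such times `t`. -/
theorem small_revealing_probabilities (a b : ℝ) (hb : 0 < b) (hab : b < a)
    (p : ℕ → ℝ) {Ω : Type*} [MeasurableSpace Ω] (μ : Measure Ω) (θ : Ω → ℕ)
    (X I Z : ℕ → Ω → ℕ) (hC : IsCascade a b p μ θ X I Z) :
    ∃ N : ℕ, ∀ t : ℕ, N ≤ t →
      (∑ i ∈ Finset.Icc 1 t, p i) ≤ 1 / (2 * Real.log (1 + a / b)) * Real.log t →
      b ^ 2 / (2 * (a + b) ^ 2) * (t : ℝ) ^ (-(0.9 : ℝ)) ≤ mapErr μ θ X Z t := by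
  refine ⟨3, fun t ht hM => ?_⟩
  have := hC.prob
  obtain ⟨n, rfl⟩ : ∃ n, t = n + 1 := ⟨t - 1, by omega⟩
  have ha : 0 < a := by linarith
  have hs : 0 < a + b := by linarith
  have hq : 0 < b / (a + b) := by positivity
  have hq1 : b / (a + b) ≤ 1 := by rw [div_le_one hs]; linarith
  have hT1 : (1 : ℝ) ≤ ((n + 1 : ℕ) : ℝ) := by exact_mod_cast (by omega : 1 ≤ n + 1)
  have hT0 : (0 : ℝ) < ((n + 1 : ℕ) : ℝ) := by linarith
  have H := cas_hist hb hab hC n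
  have hmeas := cas_measure1 hb hab hC 2 (by simp) n
  have hle : (μ {ω | θ ω = 2 ∧ (∀ s ∈ Finset.Icc 1 n, casS s (X s ω) (I s ω))}).toReal
      ≤ mapErr μ θ X Z (n + 1) := by
    unfold mapErr
    refine ENNReal.toReal_mono (by finiteness) (measure_mono ?_)
    rintro ω ⟨h1, h2⟩
    rw [← H ω] at h2
    change mapEst μ θ X Z (n + 1) ω ≠ θ ω
    rw [cas_map hb hab hC n H ω h2, h1, if_neg (by omega)]
    norm_num
  have hlow := cas_lower hb hab hC.p_mem n (by omega)
  have hsum : ∑ s ∈ Finset.Icc 1 n, p s ≤ 1 / (2 * Real.log (1 + a / b))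
      * Real.log ((n + 1 : ℕ) : ℝ) := by
    rw [Finset.sum_Icc_succ_top (by omega)] at hM
    have := (hC.p_mem (n+1) (by omega)).1
    linarith
  have hlog : 0 < Real.log (1 + a / b) := by
    apply Real.log_pos
    have : 0 < a / b := by positivity
    linarith
  have hqlog : Real.log (b / (a + b)) = - Real.log (1 + a / b) := by
    rw [← Real.log_inv]
    congr 1
    field_simp
    ring
  have hpow : ((n + 1 : ℕ) : ℝ) ^ (-(0.9 : ℝ)) ≤ (b / (a + b)) ^ (∑ s ∈ Finset.Icc 1 n, p s) := by
    rw [Real.rpow_def_of_pos hT0, Real.rpow_def_of_pos hq, hqlog]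
    apply Real.exp_le_exp.2
    have hL : 0 ≤ Real.log ((n + 1 : ℕ) : ℝ) := Real.log_nonneg hT1
    have h3 := mul_le_mul_of_nonneg_left hsum hlog.le
    have h4 : Real.log (1 + a / b) * (1 / (2 * Real.log (1 + a / b))
      * Real.log ((n + 1 : ℕ) : ℝ)) = Real.log ((n + 1 : ℕ) : ℝ) / 2 := by
      have := hlog.ne'
      generalize Real.log (1 + a / b) = l at *
      field_simp
    rw [h4] at h3
    norm_num at *
    linarith
  calc b ^ 2 / (2 * (a + b) ^ 2) * ((n + 1 : ℕ) : ℝ) ^ (-(0.9 : ℝ))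
      = 1 / 2 * ((b / (a + b)) ^ 2 * ((n + 1 : ℕ) : ℝ) ^ (-(0.9 : ℝ))) := by
        field_simp
    _ ≤ 1 / 2 * ((b / (a + b)) ^ 2 * (b / (a + b)) ^ (∑ s ∈ Finset.Icc 1 n, p s)) := by gcongr
    _ ≤ 1 / 2 * ∏ s ∈ Finset.Icc 1 n, casW a b p 2 s := by gcongr
    _ ≤ _ := by rw [← hmeas]; exact hle
end
end
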